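/- arXiv:1808.09905 — 3 statements merged into one kernel-verified Lean document; each statement's English description precedes it below -/
import Mathlib

section
/- Let E be an exact category with a projective cover P. If P has dependent full diagrams, then E is locally cartesian closed. (Equivalently: if a category C with weak finite limits has dependent full diagrams, then its exact completion C_ex is locally cartesian closed.) -/
open CategoryTheory CategoryTheory.Limits

universe v u v₂ u₂

namespace Paper

variable {C : Type u} [Category.{v} C]

/-- A weak product of `Z` and `X`: every pair of morphisms into `Z` and `X`
factors (not necessarily uniquely) through the projections. -/
def IsWeakProduct {Z X V : C} (p₁ : V ⟶ Z) (p₂ : V ⟶ X) : Prop :=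
  ∀ {W : C} (a : W ⟶ Z) (b : W ⟶ X), ∃ t : W ⟶ V, t ≫ p₁ = a ∧ t ≫ p₂ = b

/-- `f` is determined by projections with respect to the span `(p₁, p₂)`. -/
def DeterminedByProjections {Z X V Y : C} (p₁ : V ⟶ Z) (p₂ : V ⟶ X) (f : V ⟶ Y) : Prop :=
  ∀ {W : C} (a b : W ⟶ V), a ≫ p₁ = b ≫ p₁ → a ≫ p₂ = b ≫ p₂ → a ≫ f = b ≫ f

/-- A weak pullback of `f` and `g` with projections `q₁`, `q₂`. -/
def IsWeakPullback {P A B Z : C} (q₁ : P ⟶ A) (q₂ : P ⟶ B) (f : A ⟶ Z) (g : B ⟶ Z) : Prop :=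
  q₁ ≫ f = q₂ ≫ g ∧
    ∀ {W : C} (a : W ⟶ A) (b : W ⟶ B), a ≫ f = b ≫ g →
      ∃ t : W ⟶ P, t ≫ q₁ = a ∧ t ≫ q₂ = b

/-- `(W, p₁ : V ⟶ W, p₂ : V ⟶ X, e : V ⟶ Y)` is a weak exponential of `Y` and `X`. -/
def IsWeakExponential {X Y W V : C} (p₁ : V ⟶ W) (p₂ : V ⟶ X) (e : V ⟶ Y) : Prop :=
  IsWeakProduct p₁ p₂ ∧ DeterminedByProjections p₁ p₂ e ∧
    ∀ {W' V' : C} (p₁' : V' ⟶ W') (p₂' : V' ⟶ X) (e' : V' ⟶ Y),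
      IsWeakProduct p₁' p₂' → DeterminedByProjections p₁' p₂' e' →
        ∃ (h : W' ⟶ W) (k : V' ⟶ V), k ≫ p₁ = p₁' ≫ h ∧ k ≫ p₂ = p₂' ∧ k ≫ e = e'

/-- A full diagram from `X` to `Y`. -/
def IsFullDiagram {X Y U V : C} (p₁ : V ⟶ U) (p₂ : V ⟶ X) (f : V ⟶ Y) : Prop :=
  IsWeakProduct p₁ p₂ ∧
    ∀ {U' V' : C} (p₁' : V' ⟶ U') (p₂' : V' ⟶ X) (f' : V' ⟶ Y), IsWeakProduct p₁' p₂' →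
      ∃ (h : U' ⟶ U) (P : C) (q₁ : P ⟶ U') (q₂ : P ⟶ V) (k : P ⟶ V'),
        IsWeakPullback q₁ q₂ h p₁ ∧ k ≫ p₁' = q₁ ∧ k ≫ p₂' = q₂ ≫ p₂ ∧ k ≫ f' = q₂ ≫ f

def HasFullDiagrams (C : Type u) [Category.{v} C] : Prop :=
  ∀ X Y : C, ∃ (U V : C) (p₁ : V ⟶ U) (p₂ : V ⟶ X) (f : V ⟶ Y), IsFullDiagram p₁ p₂ f

def HasWeakExponentials (C : Type u) [Category.{v} C] : Prop :=
  ∀ X Y : C, ∃ (W V : C) (p₁ : V ⟶ W) (p₂ : V ⟶ X) (e : V ⟶ Y), IsWeakExponential p₁ p₂ e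

/-- A dependent full diagram over `x : X ⟶ J` and `y : Y ⟶ X`. -/
def IsDepFullDiagram {J X Y U V : C} (x : X ⟶ J) (y : Y ⟶ X)
    (u : U ⟶ J) (p₁ : V ⟶ U) (p₂ : V ⟶ X) (f : V ⟶ Y) : Prop :=
  IsWeakPullback p₁ p₂ u x ∧ f ≫ y = p₂ ∧
    ∀ {U' V' : C} (u' : U' ⟶ J) (p₁' : V' ⟶ U') (p₂' : V' ⟶ X) (f' : V' ⟶ Y),
      IsWeakPullback p₁' p₂' u' x → f' ≫ y = p₂' →
        ∃ h : U' ⟶ U, h ≫ u = u' ∧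
          ∃ (P : C) (q₁ : P ⟶ V) (q₂ : P ⟶ U') (k : P ⟶ V'),
            IsWeakPullback q₁ q₂ p₁ h ∧ k ≫ p₁' = q₂ ∧ k ≫ f' = q₁ ≫ f

/-- A weak dependent product of `y : Y ⟶ X` and `x : X ⟶ J`. -/
def IsWeakDepProd {J X Y U V : C} (x : X ⟶ J) (y : Y ⟶ X)
    (u : U ⟶ J) (p₁ : V ⟶ U) (p₂ : V ⟶ X) (f : V ⟶ Y) : Prop :=
  IsWeakPullback p₁ p₂ u x ∧ f ≫ y = p₂ ∧ DeterminedByProjections p₁ p₂ f ∧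
    ∀ {U' V' : C} (u' : U' ⟶ J) (p₁' : V' ⟶ U') (p₂' : V' ⟶ X) (f' : V' ⟶ Y),
      IsWeakPullback p₁' p₂' u' x → f' ≫ y = p₂' →
        ∃ (h : U' ⟶ U) (k : V' ⟶ V),
          h ≫ u = u' ∧ k ≫ p₁ = p₁' ≫ h ∧ k ≫ p₂ = p₂' ∧ k ≫ f = f'

def HasDepFullDiagrams (C : Type u) [Category.{v} C] : Prop :=
  ∀ {J X Y : C} (x : X ⟶ J) (y : Y ⟶ X),
    ∃ (U V : C) (u : U ⟶ J) (p₁ : V ⟶ U) (p₂ : V ⟶ X) (f : V ⟶ Y),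
      IsDepFullDiagram x y u p₁ p₂ f

def HasWeakDepProds (C : Type u) [Category.{v} C] : Prop :=
  ∀ {J X Y : C} (x : X ⟶ J) (y : Y ⟶ X),
    ∃ (U V : C) (u : U ⟶ J) (p₁ : V ⟶ U) (p₂ : V ⟶ X) (f : V ⟶ Y),
      IsWeakDepProd x y u p₁ p₂ f

/-- A category has weak finite limits if every finite diagram admits a weak limit,
i.e. a cone through which every cone factors (not necessarily uniquely). -/
def HasWeakFiniteLimits (C : Type u) [Category.{v} C] : Prop :=
  ∀ (J : Type) (_ : SmallCategory J) (_ : FinCategory J) (F : J ⥤ C),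
    ∃ c : Cone F, ∀ d : Cone F, Nonempty (d ⟶ c)

end Paper
namespace Paper

variable {E : Type u} [Category.{v} E]

/-- An internal equivalence relation, expressed via generalized elements:
the pair `(r₁, r₂)` is jointly monic, reflexive, symmetric and transitive. -/
def IsInternalEquivRel {R X : E} (r₁ r₂ : R ⟶ X) : Prop :=
  (∀ {W : E} (a b : W ⟶ R), a ≫ r₁ = b ≫ r₁ → a ≫ r₂ = b ≫ r₂ → a = b) ∧
  (∀ {W : E} (x : W ⟶ X), ∃ d : W ⟶ R, d ≫ r₁ = x ∧ d ≫ r₂ = x) ∧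
  (∀ {W : E} (a : W ⟶ R), ∃ b : W ⟶ R, b ≫ r₁ = a ≫ r₂ ∧ b ≫ r₂ = a ≫ r₁) ∧
  (∀ {W : E} (a b : W ⟶ R), a ≫ r₂ = b ≫ r₁ →
    ∃ c : W ⟶ R, c ≫ r₁ = a ≫ r₁ ∧ c ≫ r₂ = b ≫ r₂)

/-- A Barr-exact category: a regular category (finite limits together with
pullback-stable regular epi–mono factorisations) in which every internal
equivalence relation is effective (is a kernel pair). -/
class ExactCategory (E : Type u) [Category.{v} E] : Prop where
  hasFiniteLimits : HasFiniteLimits E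
  regEpiMonoFactorisation : ∀ {A B : E} (f : A ⟶ B),
    ∃ (I : E) (e : A ⟶ I) (m : I ⟶ B), Nonempty (RegularEpi e) ∧ Mono m ∧ e ≫ m = f
  regEpiStable : ∀ {A B X P : E} (f : A ⟶ B) (g : X ⟶ B) (p₁ : P ⟶ A) (p₂ : P ⟶ X),
    IsPullback p₁ p₂ f g → Nonempty (RegularEpi f) → Nonempty (RegularEpi p₂)
  equivRelEffective : ∀ {R X : E} (r₁ r₂ : R ⟶ X), IsInternalEquivRel r₁ r₂ →
    ∃ (Y : E) (q : X ⟶ Y), IsKernelPair q r₁ r₂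

attribute [instance] ExactCategory.hasFiniteLimits

/-- `P` is (the object class of) a projective cover of `E`: every object satisfying `P`
is regular projective and every object of `E` is covered by a regular epi from an
object satisfying `P`. -/
def IsProjectiveCover (P : E → Prop) : Prop :=
  (∀ {X : E}, P X → ∀ {A B : E} (g : A ⟶ B), Nonempty (RegularEpi g) →
    ∀ f : X ⟶ B, ∃ f' : X ⟶ A, f' ≫ g = f) ∧
  (∀ A : E, ∃ (X : E) (p : X ⟶ A), P X ∧ Nonempty (RegularEpi p))

section Relative

variable (P : E → Prop)

/-- Weak product relative to the full subcategory on `P`. -/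
def IsWeakProductOn {Z X V : E} (p₁ : V ⟶ Z) (p₂ : V ⟶ X) : Prop :=
  ∀ {W : E}, P W → ∀ (a : W ⟶ Z) (b : W ⟶ X), ∃ t : W ⟶ V, t ≫ p₁ = a ∧ t ≫ p₂ = b

/-- Determined by projections, relative to the full subcategory on `P`. -/
def DeterminedByProjectionsOn {Z X V Y : E} (p₁ : V ⟶ Z) (p₂ : V ⟶ X) (f : V ⟶ Y) : Prop :=
  ∀ {W : E}, P W → ∀ (a b : W ⟶ V), a ≫ p₁ = b ≫ p₁ → a ≫ p₂ = b ≫ p₂ → a ≫ f = b ≫ f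

/-- Weak pullback relative to the full subcategory on `P`. -/
def IsWeakPullbackOn {Q A B Z : E} (q₁ : Q ⟶ A) (q₂ : Q ⟶ B) (f : A ⟶ Z) (g : B ⟶ Z) : Prop :=
  q₁ ≫ f = q₂ ≫ g ∧
    ∀ {W : E}, P W → ∀ (a : W ⟶ A) (b : W ⟶ B), a ≫ f = b ≫ g →
      ∃ t : W ⟶ Q, t ≫ q₁ = a ∧ t ≫ q₂ = b

/-- Full diagram from `X` to `Y` relative to the full subcategory on `P`. -/
def IsFullDiagramOn {X Y U V : E} (p₁ : V ⟶ U) (p₂ : V ⟶ X) (f : V ⟶ Y) : Prop :=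
  IsWeakProductOn P p₁ p₂ ∧
    ∀ {U' V' : E}, P U' → P V' → ∀ (p₁' : V' ⟶ U') (p₂' : V' ⟶ X) (f' : V' ⟶ Y),
      IsWeakProductOn P p₁' p₂' →
        ∃ (h : U' ⟶ U) (Q : E) (_ : P Q) (q₁ : Q ⟶ U') (q₂ : Q ⟶ V) (k : Q ⟶ V'),
          IsWeakPullbackOn P q₁ q₂ h p₁ ∧ k ≫ p₁' = q₁ ∧ k ≫ p₂' = q₂ ≫ p₂ ∧ k ≫ f' = q₂ ≫ f

/-- The full subcategory on `P` has full diagrams. -/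
def HasFullDiagramsOn : Prop :=
  ∀ {X Y : E}, P X → P Y →
    ∃ (U V : E) (_ : P U) (_ : P V) (p₁ : V ⟶ U) (p₂ : V ⟶ X) (f : V ⟶ Y),
      IsFullDiagramOn P p₁ p₂ f

/-- Weak exponential relative to the full subcategory on `P`. -/
def IsWeakExponentialOn {X Y W V : E} (p₁ : V ⟶ W) (p₂ : V ⟶ X) (e : V ⟶ Y) : Prop :=
  IsWeakProductOn P p₁ p₂ ∧ DeterminedByProjectionsOn P p₁ p₂ e ∧
    ∀ {W' V' : E}, P W' → P V' → ∀ (p₁' : V' ⟶ W') (p₂' : V' ⟶ X) (e' : V' ⟶ Y),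
      IsWeakProductOn P p₁' p₂' → DeterminedByProjectionsOn P p₁' p₂' e' →
        ∃ (h : W' ⟶ W) (k : V' ⟶ V), k ≫ p₁ = p₁' ≫ h ∧ k ≫ p₂ = p₂' ∧ k ≫ e = e'

/-- The full subcategory on `P` has weak exponentials. -/
def HasWeakExponentialsOn : Prop :=
  ∀ {X Y : E}, P X → P Y →
    ∃ (W V : E) (_ : P W) (_ : P V) (p₁ : V ⟶ W) (p₂ : V ⟶ X) (e : V ⟶ Y),
      IsWeakExponentialOn P p₁ p₂ e

/-- Dependent full diagram relative to the full subcategory on `P`. -/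
def IsDepFullDiagramOn {J X Y U V : E} (x : X ⟶ J) (y : Y ⟶ X)
    (u : U ⟶ J) (p₁ : V ⟶ U) (p₂ : V ⟶ X) (f : V ⟶ Y) : Prop :=
  IsWeakPullbackOn P p₁ p₂ u x ∧ f ≫ y = p₂ ∧
    ∀ {U' V' : E}, P U' → P V' → ∀ (u' : U' ⟶ J) (p₁' : V' ⟶ U') (p₂' : V' ⟶ X) (f' : V' ⟶ Y),
      IsWeakPullbackOn P p₁' p₂' u' x → f' ≫ y = p₂' →
        ∃ h : U' ⟶ U, h ≫ u = u' ∧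
          ∃ (Q : E) (_ : P Q) (q₁ : Q ⟶ V) (q₂ : Q ⟶ U') (k : Q ⟶ V'),
            IsWeakPullbackOn P q₁ q₂ p₁ h ∧ k ≫ p₁' = q₂ ∧ k ≫ f' = q₁ ≫ f

/-- The full subcategory on `P` has dependent full diagrams. -/
def HasDepFullDiagramsOn : Prop :=
  ∀ {J X Y : E}, P J → P X → P Y → ∀ (x : X ⟶ J) (y : Y ⟶ X),
    ∃ (U V : E) (_ : P U) (_ : P V) (u : U ⟶ J) (p₁ : V ⟶ U) (p₂ : V ⟶ X) (f : V ⟶ Y),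
      IsDepFullDiagramOn P x y u p₁ p₂ f

/-- Weak dependent product relative to the full subcategory on `P`. -/
def IsWeakDepProdOn {J X Y U V : E} (x : X ⟶ J) (y : Y ⟶ X)
    (u : U ⟶ J) (p₁ : V ⟶ U) (p₂ : V ⟶ X) (f : V ⟶ Y) : Prop :=
  IsWeakPullbackOn P p₁ p₂ u x ∧ f ≫ y = p₂ ∧ DeterminedByProjectionsOn P p₁ p₂ f ∧
    ∀ {U' V' : E}, P U' → P V' → ∀ (u' : U' ⟶ J) (p₁' : V' ⟶ U') (p₂' : V' ⟶ X) (f' : V' ⟶ Y),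
      IsWeakPullbackOn P p₁' p₂' u' x → f' ≫ y = p₂' →
        ∃ (h : U' ⟶ U) (k : V' ⟶ V),
          h ≫ u = u' ∧ k ≫ p₁ = p₁' ≫ h ∧ k ≫ p₂ = p₂' ∧ k ≫ f = f'

/-- The full subcategory on `P` has weak dependent products. -/
def HasWeakDepProdsOn : Prop :=
  ∀ {J X Y : E}, P J → P X → P Y → ∀ (x : X ⟶ J) (y : Y ⟶ X),
    ∃ (U V : E) (_ : P U) (_ : P V) (u : U ⟶ J) (p₁ : V ⟶ U) (p₂ : V ⟶ X) (f : V ⟶ Y),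
      IsWeakDepProdOn P x y u p₁ p₂ f

/-- An object over `X` with vertex in the full subcategory on `P`. -/
structure OverIn (X : E) where
  V : E
  hV : P V
  hom : V ⟶ X

/-- The preorder on `OverIn P X` whose poset reflection is the poset reflection
of the slice category of the full subcategory on `P` over `X`. -/
instance {X : E} : Preorder (OverIn P X) where
  le a b := ∃ t : a.V ⟶ b.V, t ≫ b.hom = a.hom
  le_refl a := ⟨𝟙 _, by simp⟩
  le_trans a b c := by
    rintro ⟨t, ht⟩ ⟨s, hs⟩
    exact ⟨t ≫ s, by simp [Category.assoc, hs, ht]⟩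

/-- The full subcategory on `P` has right adjoints to the (poset-reflected)
weak pullback functors along all of its morphisms. -/
def HasRightAdjointsToWeakPullbacksOn : Prop :=
  ∀ {X Y : E}, P X → P Y → ∀ f : Y ⟶ X,
    ∃ wp : OverIn P X → OverIn P Y,
      (∀ a : OverIn P X, ∃ m : (wp a).V ⟶ a.V,
        IsWeakPullbackOn P m (wp a).hom a.hom f) ∧
      ∃ ra : OverIn P Y → OverIn P X,
        ∀ (a : OverIn P X) (b : OverIn P Y), wp a ≤ b ↔ a ≤ ra b

end Relative

/-- `ev : W ⨯ X ⟶ Y` exhibits `W` as an exponential of `Y` by `X`. -/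
def IsExponential [HasBinaryProducts E] (X Y W : E) (ev : W ⨯ X ⟶ Y) : Prop :=
  ∀ {Z : E} (g : Z ⨯ X ⟶ Y), ∃! h : Z ⟶ W, prod.map h (𝟙 X) ≫ ev = g

/-- A category with binary products is cartesian closed if every pair of objects
has an exponential. -/
def IsCartesianClosed (E : Type u) [Category.{v} E] [HasBinaryProducts E] : Prop :=
  ∀ X Y : E, ∃ (W : E) (ev : W ⨯ X ⟶ Y), IsExponential X Y W ev

/-- A category with finite limits is locally cartesian closed if all its slices
are cartesian closed. -/
def IsLocallyCartesianClosed (E : Type u) [Category.{v} E] [HasFiniteLimits E] : Prop :=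
  ∀ X : E, IsCartesianClosed (Over X)

end Paper
namespace Paper

section ProjectiveElements

variable {E : Type u} [Category.{v} E] {P : E → Prop}

/-- Every element of `B` parametrised by an object of `P` lifts along `g`. -/
def LiftsElements (P : E → Prop) {A B : E} (g : A ⟶ B) : Prop :=
  ∀ {W : E}, P W → ∀ b : W ⟶ B, ∃ a : W ⟶ A, a ≫ g = b

namespace IsProjectiveCover

theorem exists_cover (hP : IsProjectiveCover P) (A : E) :
    ∃ (X : E) (p : X ⟶ A), P X ∧ LiftsElements P p := by
  obtain ⟨X, p, hX, hp⟩ := hP.2 A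
  exact ⟨X, p, hX, fun hW b => hP.1 hW p hp b⟩

theorem hom_ext (hP : IsProjectiveCover P) {A B : E} {f g : A ⟶ B}
    (h : ∀ {W : E}, P W → ∀ a : W ⟶ A, a ≫ f = a ≫ g) : f = g := by
  obtain ⟨X, p, hX, ⟨hp⟩⟩ := hP.2 A
  have := hp.epi
  exact (cancel_epi p).1 (h hX p)

theorem exists_desc_of_regularEpi (hP : IsProjectiveCover P) {A B Y : E} {g : A ⟶ B}
    (hg : Nonempty (RegularEpi g)) (k : A ⟶ Y)
    (hk : ∀ {W : E}, P W → ∀ a a' : W ⟶ A, a ≫ g = a' ≫ g → a ≫ k = a' ≫ k) :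
    ∃ l : B ⟶ Y, g ≫ l = k := by
  obtain ⟨hg⟩ := hg
  have h : hg.left ≫ k = hg.right ≫ k := hP.hom_ext fun hW a => by
    simpa using hk hW (a ≫ hg.left) (a ≫ hg.right) (by simp [hg.w])
  exact ⟨hg.isColimit.desc (Cofork.ofπ k h), hg.isColimit.fac (Cofork.ofπ k h) .one⟩

variable [ExactCategory E]

theorem exists_desc (hP : IsProjectiveCover P) {A B Y : E} {g : A ⟶ B}
    (hg : LiftsElements P g) (k : A ⟶ Y)
    (hk : ∀ {W : E}, P W → ∀ a a' : W ⟶ A, a ≫ g = a' ≫ g → a ≫ k = a' ≫ k) :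
    ∃ l : B ⟶ Y, g ≫ l = k := by
  obtain ⟨I, e, m, he, hm, rfl⟩ := ExactCategory.regEpiMonoFactorisation g
  obtain ⟨k₁, rfl⟩ := hP.exists_desc_of_regularEpi he k
    fun hW a a' h => hk hW a a' (by simp only [reassoc_of% h])
  obtain ⟨X, p, hX, hp⟩ := hP.2 B
  obtain ⟨l, hl⟩ := hg hX p
  obtain ⟨n, hn⟩ := hP.exists_desc_of_regularEpi hp (l ≫ e) fun hW a a' h => by
    rw [← cancel_mono m]
    simpa [hl] using h
  have := hp.some.epi
  have hnm : n ≫ m = 𝟙 B := by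
    rw [← cancel_epi p, reassoc_of% hn, hl, Category.comp_id]
  have hmn : m ≫ n = 𝟙 I := by
    rw [← cancel_mono m, Category.assoc, hnm, Category.comp_id, Category.id_comp]
  exact ⟨n ≫ k₁, by simp [reassoc_of% hmn]⟩

theorem exists_image (hP : IsProjectiveCover P) {A B : E} (f : A ⟶ B) :
    ∃ (I : E) (e : A ⟶ I) (m : I ⟶ B), LiftsElements P e ∧ Mono m ∧ e ≫ m = f := by
  obtain ⟨I, e, m, he, hm, h⟩ := ExactCategory.regEpiMonoFactorisation f
  exact ⟨I, e, m, fun hW b => hP.1 hW e he b, hm, h⟩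

theorem exists_lift_of_mono (hP : IsProjectiveCover P) {A T J : E} (m : A ⟶ J) [Mono m]
    (t : T ⟶ J)
    (h : ∀ {W : E}, P W → ∀ w : W ⟶ T, ∃ l : W ⟶ A, l ≫ m = w ≫ t) :
    ∃ l : T ⟶ A, l ≫ m = t := by
  obtain ⟨X, p, hX, hp⟩ := hP.exists_cover T
  obtain ⟨l, hl⟩ := h hX p
  obtain ⟨l', hl'⟩ := hP.exists_desc hp l fun hW a a' h => by
    rw [← cancel_mono m]
    simp [hl, reassoc_of% h]
  refine ⟨l', hP.hom_ext fun hW a => ?_⟩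
  obtain ⟨a', rfl⟩ := hp hW a
  simp [reassoc_of% hl', hl]

theorem exists_weakPullback (hP : IsProjectiveCover P) {A B C : E} (f : A ⟶ C) (g : B ⟶ C) :
    ∃ (Q : E) (_ : P Q) (q₁ : Q ⟶ A) (q₂ : Q ⟶ B), IsWeakPullbackOn P q₁ q₂ f g := by
  obtain ⟨Q, q, hQ, hq⟩ := hP.exists_cover (pullback f g)
  refine ⟨Q, hQ, q ≫ pullback.fst f g, q ≫ pullback.snd f g, by simp [pullback.condition], ?_⟩
  intro W hW a b h
  obtain ⟨t, ht⟩ := hq hW (pullback.lift a b h)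
  exact ⟨t, by rw [reassoc_of% ht, pullback.lift_fst], by rw [reassoc_of% ht, pullback.lift_snd]⟩

/-- Universal quantification along `x` of the equaliser of `a` and `b`. -/
theorem exists_forall_eq (hP : IsProjectiveCover P) (hfull : HasDepFullDiagramsOn P)
    {J X Y : E} (x : X ⟶ J) (a b : X ⟶ Y) :
    ∃ (A : E) (m : A ⟶ J), Mono m ∧ ∀ {T : E} (t : T ⟶ J), (∃ l : T ⟶ A, l ≫ m = t) ↔
      ∀ {W : E}, P W → ∀ (w : W ⟶ T) (v : W ⟶ X), w ≫ t = v ≫ x → v ≫ a = v ≫ b := by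
  obtain ⟨J', j, hJ', hj⟩ := hP.exists_cover J
  obtain ⟨X', hX', ξ, x', hξ⟩ := hP.exists_weakPullback x j
  obtain ⟨Y', i, hY', hi⟩ := hP.exists_cover (equalizer (ξ ≫ a) (ξ ≫ b))
  obtain ⟨U, V, hU, hV, u, p₁, p₂, f, hV₁, hf, hmin⟩ :=
    hfull hJ' hX' hY' x' (i ≫ equalizer.ι _ _)
  obtain ⟨A, e, m, he, hm, hem⟩ := hP.exists_image (u ≫ j)
  refine ⟨A, m, hm, fun {T} t => ⟨?_, fun h => ?_⟩⟩
  · rintro ⟨l, rfl⟩ W hW w v hwv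
    obtain ⟨z, hz⟩ := he hW (w ≫ l)
    obtain ⟨v', rfl, hv'⟩ := hξ.2 hW v (z ≫ u) (by
      rw [← hwv, Category.assoc, ← hem, reassoc_of% hz])
    obtain ⟨r, -, rfl⟩ := hV₁.2 hW z v' hv'.symm
    simp only [← hf, Category.assoc, equalizer.condition (ξ ≫ a) (ξ ≫ b)]
  · refine hP.exists_lift_of_mono m t fun {W} hW w => ?_
    obtain ⟨t', ht'⟩ := hj hW (w ≫ t)
    obtain ⟨D, hD, d₁, d₂, hd⟩ := hP.exists_weakPullback t' x'
    obtain ⟨f', hf'⟩ := hi hD (equalizer.lift (f := ξ ≫ a) (g := ξ ≫ b) d₂ (by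
      have := h hD (d₁ ≫ w) (d₂ ≫ ξ) (by
        rw [Category.assoc, ← ht', reassoc_of% hd.1, Category.assoc, hξ.1])
      simpa using this))
    obtain ⟨c, rfl, -⟩ := hmin hW hD t' d₁ d₂ f' hd (by simp [reassoc_of% hf'])
    exact ⟨c ≫ e, by rw [Category.assoc, hem, ← ht', Category.assoc]⟩

end IsProjectiveCover

end ProjectiveElements

section OverProd

variable {E : Type u} [Category.{v} E] [HasFiniteLimits E] {J : E}

/-- The generalised element of a product in `Over J` with the given components. -/
noncomputable def overPair {Z A : Over J} {W : E} (w : W ⟶ Z.left) (a : W ⟶ A.left)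
    (h : w ≫ Z.hom = a ≫ A.hom) : W ⟶ (Z ⨯ A).left :=
  (prod.lift (Over.homMk w : Over.mk (w ≫ Z.hom) ⟶ Z)
    (Over.homMk a h.symm : Over.mk (w ≫ Z.hom) ⟶ A)).left

variable {Z A : Over J} {W : E}

@[simp]
theorem overPair_fst (w : W ⟶ Z.left) (a : W ⟶ A.left) (h : w ≫ Z.hom = a ≫ A.hom) :
    overPair w a h ≫ (prod.fst : Z ⨯ A ⟶ Z).left = w := by
  rw [overPair, ← Over.comp_left, prod.lift_fst]
  rfl

@[simp]
theorem overPair_snd (w : W ⟶ Z.left) (a : W ⟶ A.left) (h : w ≫ Z.hom = a ≫ A.hom) :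
    overPair w a h ≫ (prod.snd : Z ⨯ A ⟶ A).left = a := by
  rw [overPair, ← Over.comp_left, prod.lift_snd]
  rfl

theorem overProd_hom_ext {f g : W ⟶ (Z ⨯ A).left}
    (h₁ : f ≫ (prod.fst : Z ⨯ A ⟶ Z).left = g ≫ (prod.fst : Z ⨯ A ⟶ Z).left)
    (h₂ : f ≫ (prod.snd : Z ⨯ A ⟶ A).left = g ≫ (prod.snd : Z ⨯ A ⟶ A).left) : f = g := by
  have hfg : g ≫ (Z ⨯ A).hom = f ≫ (Z ⨯ A).hom := by
    rw [← Over.w (prod.fst : Z ⨯ A ⟶ Z), reassoc_of% h₁]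
  have : (Over.homMk f : Over.mk (f ≫ (Z ⨯ A).hom) ⟶ Z ⨯ A) = Over.homMk g hfg := by
    apply Limits.prod.hom_ext
    · ext
      exact h₁
    · ext
      exact h₂
  exact congrArg CommaMorphism.left this

theorem exists_eq_overPair (f : W ⟶ (Z ⨯ A).left) :
    ∃ (w : W ⟶ Z.left) (a : W ⟶ A.left) (h : w ≫ Z.hom = a ≫ A.hom), f = overPair w a h :=
  ⟨f ≫ (prod.fst : Z ⨯ A ⟶ Z).left, f ≫ (prod.snd : Z ⨯ A ⟶ A).left, by simp,
    overProd_hom_ext (by simp) (by simp)⟩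

theorem comp_overPair {W' : E} (k : W' ⟶ W) (w : W ⟶ Z.left) (a : W ⟶ A.left)
    (h : w ≫ Z.hom = a ≫ A.hom) :
    k ≫ overPair w a h = overPair (k ≫ w) (k ≫ a) (by simp [h]) :=
  overProd_hom_ext (by simp) (by simp)

theorem overPair_hom (w : W ⟶ Z.left) (a : W ⟶ A.left) (h : w ≫ Z.hom = a ≫ A.hom) :
    overPair w a h ≫ (Z ⨯ A).hom = w ≫ Z.hom := by
  rw [← Over.w (prod.fst : Z ⨯ A ⟶ Z), ← Category.assoc, overPair_fst]

theorem overPair_map {Z' : Over J} (f : Z ⟶ Z') (w : W ⟶ Z.left) (a : W ⟶ A.left)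
    (h : w ≫ Z.hom = a ≫ A.hom) :
    overPair w a h ≫ (prod.map f (𝟙 A)).left = overPair (w ≫ f.left) a (by simp [h]) := by
  apply overProd_hom_ext
  · rw [Category.assoc, ← Over.comp_left, prod.map_fst, Over.comp_left, ← Category.assoc,
      overPair_fst, overPair_fst]
  · rw [Category.assoc, ← Over.comp_left, prod.map_snd, Over.comp_left, ← Category.assoc,
      overPair_snd, overPair_snd]
    simp

end OverProd

section Exponential

variable {E : Type u} [Category.{v} E] [ExactCategory E] {P : E → Prop} {J : E}

theorem IsProjectiveCover.over_hom_ext (hP : IsProjectiveCover P) {Z A B : Over J}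
    {f g : Z ⨯ A ⟶ B}
    (h : ∀ {W : E}, P W → ∀ (w : W ⟶ Z.left) (a : W ⟶ A.left) (e : w ≫ Z.hom = a ≫ A.hom),
      overPair w a e ≫ f.left = overPair w a e ≫ g.left) : f = g := by
  refine Over.OverMorphism.ext (hP.hom_ext fun hW k => ?_)
  obtain ⟨w, a, e, rfl⟩ := exists_eq_overPair k
  exact h hW w a e

/-- A family of maps from `A` to `B` over `J` such that every family parametrised by an
object of `P` is obtained from it by reindexing. -/
def IsWeaklyGeneric (P : E → Prop) {A B G : Over J} (s : G ⨯ A ⟶ B) : Prop :=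
  ∀ {Z : Over J}, P Z.left → ∀ g : Z ⨯ A ⟶ B, ∃ h : Z ⟶ G, prod.map h (𝟙 A) ≫ s = g

theorem IsProjectiveCover.exists_isWeaklyGeneric (hP : IsProjectiveCover P)
    (hfull : HasDepFullDiagramsOn P) (A B : Over J) :
    ∃ (G : Over J) (s : G ⨯ A ⟶ B), IsWeaklyGeneric P s := by
  obtain ⟨J', j, hJ', hj⟩ := hP.exists_cover J
  obtain ⟨X', hX', ξ, x', hξ⟩ := hP.exists_weakPullback A.hom j
  obtain ⟨Y', hY', y', β, hβ⟩ := hP.exists_weakPullback (ξ ≫ A.hom) B.hom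
  obtain ⟨U, V, hU, hV, u, p₁, p₂, f, hV₁, hf, hmin⟩ := hfull hJ' hX' hY' x' y'
  obtain ⟨K, hK, k₁, k₂, hk⟩ :=
    hP.exists_weakPullback (prod.lift p₁ (p₂ ≫ ξ)) (prod.lift p₁ (p₂ ≫ ξ))
  obtain ⟨U₀, m, hm, hU₀⟩ :=
    hP.exists_forall_eq hfull (k₁ ≫ p₁) (k₁ ≫ f ≫ β) (k₂ ≫ f ≫ β)
  have hfun : ∀ {T : E} (t : T ⟶ U), (∃ l : T ⟶ U₀, l ≫ m = t) ↔
      ∀ {W : E}, P W → ∀ (w : W ⟶ T) (v v' : W ⟶ V), v ≫ p₁ = w ≫ t → v' ≫ p₁ = w ≫ t →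
        v ≫ p₂ ≫ ξ = v' ≫ p₂ ≫ ξ → v ≫ f ≫ β = v' ≫ f ≫ β := by
    intro T t
    refine (hU₀ t).trans ⟨fun h W hW w v v' h₁ h₂ h₃ => ?_, fun h W hW w κ hκ => ?_⟩
    · obtain ⟨κ, rfl, rfl⟩ := hk.2 hW v v' (by
        apply Limits.prod.hom_ext
        · simp [h₁, h₂, prod.lift_fst]
        · simpa [prod.lift_snd] using h₃)
      simpa using h hW w κ (by simpa using h₁.symm)
    · have h₁ : k₁ ≫ p₁ = k₂ ≫ p₁ := by simpa [prod.lift_fst] using hk.1 =≫ prod.fst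
      have h₂ : k₁ ≫ p₂ ≫ ξ = k₂ ≫ p₂ ≫ ξ := by simpa [prod.lift_snd] using hk.1 =≫ prod.snd
      simpa using h hW w (κ ≫ k₁) (κ ≫ k₂) (by simp [hκ]) (by simp [hκ, h₁]) (by simp [h₂])
  have hφ : f ≫ β ≫ B.hom = p₂ ≫ ξ ≫ A.hom := by
    rw [← hβ.1, ← hf, Category.assoc]
  have hpJ : p₁ ≫ u ≫ j = p₂ ≫ ξ ≫ A.hom := by
    rw [hξ.1, reassoc_of% hV₁.1]
  have lift_elt : ∀ {W : E}, P W → ∀ (w : W ⟶ U) (a : W ⟶ A.left),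
      w ≫ u ≫ j = a ≫ A.hom → ∃ v : W ⟶ V, v ≫ p₁ = w ∧ v ≫ p₂ ≫ ξ = a := by
    intro W hW w a h
    obtain ⟨a', rfl, ha'⟩ := hξ.2 hW a (w ≫ u) (by simp [← h])
    obtain ⟨v, rfl, rfl⟩ := hV₁.2 hW w a' ha'.symm
    exact ⟨v, rfl, by simp⟩
  let G : Over J := Over.mk (m ≫ u ≫ j)
  obtain ⟨V₀, hV₀, v₀, v₁, hv⟩ := hP.exists_weakPullback p₁ m
  have hv' : v₁ ≫ m ≫ u ≫ j = (v₀ ≫ p₂ ≫ ξ) ≫ A.hom := by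
    rw [← reassoc_of% hv.1, hpJ]
    simp
  let c : V₀ ⟶ (G ⨯ A).left := overPair (Z := G) v₁ (v₀ ≫ p₂ ≫ ξ) hv'
  have hc : LiftsElements P c := by
    intro W hW b
    obtain ⟨w, a, e, rfl⟩ := exists_eq_overPair b
    obtain ⟨v, h₁, rfl⟩ := lift_elt hW (w ≫ m) a (by simpa [G] using e)
    obtain ⟨r, rfl, rfl⟩ := hv.2 hW v w h₁
    exact ⟨r, by simp [c, comp_overPair]⟩
  obtain ⟨s, hs⟩ := hP.exists_desc hc (v₀ ≫ f ≫ β) (by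
    intro W hW a a' h
    have h₁ : a ≫ v₁ = a' ≫ v₁ := by
      simpa [c] using h =≫ (prod.fst : G ⨯ A ⟶ G).left
    have h₂ : a ≫ v₀ ≫ p₂ ≫ ξ = a' ≫ v₀ ≫ p₂ ≫ ξ := by
      simpa [c] using h =≫ (prod.snd : G ⨯ A ⟶ A).left
    simpa using (hfun m).1 ⟨𝟙 _, by simp⟩ hW (a ≫ v₁) (a ≫ v₀) (a' ≫ v₀)
      (by simp [hv.1]) (by simp [hv.1, reassoc_of% h₁]) (by simpa using h₂))
  have hs_elt : ∀ {W : E}, P W → ∀ (w : W ⟶ U₀) (v : W ⟶ V) (e : v ≫ p₁ = w ≫ m)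
      (a : W ⟶ A.left) (e' : w ≫ G.hom = a ≫ A.hom), a = v ≫ p₂ ≫ ξ →
      overPair (Z := G) w a e' ≫ s = v ≫ f ≫ β := by
    rintro W hW w v e a e' rfl
    obtain ⟨r, rfl, rfl⟩ := hv.2 hW v w e
    have : overPair (Z := G) (r ≫ v₁) ((r ≫ v₀) ≫ p₂ ≫ ξ) e' = r ≫ c := by
      simp [c, comp_overPair]
    rw [this, Category.assoc, hs]
    simp
  refine ⟨G, Over.homMk s ?_, ?_⟩
  · refine hP.hom_ext fun {W} hW b => ?_
    obtain ⟨r, rfl⟩ := hc hW b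
    have : c ≫ (G ⨯ A).hom = v₁ ≫ m ≫ u ≫ j := overPair_hom _ _ _
    rw [Category.assoc, Category.assoc, reassoc_of% hs, this, hφ, hv']
    simp
  · intro Z hZ g
    obtain ⟨t, ht⟩ := hj hZ Z.hom
    obtain ⟨D, hD, d₁, d₂, hd⟩ := hP.exists_weakPullback t x'
    have hd' : d₁ ≫ Z.hom = (d₂ ≫ ξ) ≫ A.hom := by
      rw [← ht, reassoc_of% hd.1, Category.assoc, hξ.1]
    obtain ⟨f', hf'₁, hf'₂⟩ := hβ.2 hD d₂ (overPair d₁ (d₂ ≫ ξ) hd' ≫ g.left) (by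
      rw [Category.assoc, Over.w, overPair_hom, hd', Category.assoc])
    obtain ⟨h₀, rfl, Q, hQ, q₁, q₂, k, hq, hk₁, hk₂⟩ := hmin hZ hD t d₁ d₂ f' hd hf'₁
    have key : ∀ {W : E}, P W → ∀ (w : W ⟶ Z.left) (v : W ⟶ V), v ≫ p₁ = w ≫ h₀ →
        ∀ (a : W ⟶ A.left) (e : w ≫ Z.hom = a ≫ A.hom), a = v ≫ p₂ ≫ ξ →
        v ≫ f ≫ β = overPair w a e ≫ g.left := by
      rintro W hW w v hvw a e rfl
      obtain ⟨r, rfl, rfl⟩ := hq.2 hW v w hvw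
      have hkd : k ≫ d₂ = q₁ ≫ p₂ := by rw [← hf'₁, reassoc_of% hk₂, hf]
      rw [Category.assoc, ← reassoc_of% hk₂, hf'₂, ← Category.assoc, ← Category.assoc,
        comp_overPair]
      congr 2
      · simp [hk₁]
      · simp [reassoc_of% hkd]
    obtain ⟨l, hl⟩ := (hfun h₀).2 (by
      intro W hW w v v' h₁ h₂ h₃
      have e : w ≫ Z.hom = (v ≫ p₂ ≫ ξ) ≫ A.hom := by
        rw [← ht, Category.assoc, ← reassoc_of% h₁, hpJ]
        simp
      rw [key hW w v h₁ _ e rfl, key hW w v' h₂ _ e h₃])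
    refine ⟨Over.homMk l ?_, hP.over_hom_ext fun {W} hW w a e => ?_⟩
    · simp [G, reassoc_of% hl, ← ht]
    · obtain ⟨v, h₁, h₂⟩ := lift_elt hW (w ≫ h₀) a (by simpa [← ht] using e)
      rw [Over.comp_left, ← Category.assoc, overPair_map, ← key hW w v h₁ a e h₂.symm]
      exact hs_elt hW _ v (by simp [h₁, hl]) _ _ h₂.symm

/-- The quotient of a family of maps by extensional equality. -/
theorem IsProjectiveCover.exists_extensional_quotient (hP : IsProjectiveCover P)
    (hfull : HasDepFullDiagramsOn P) {A B G : Over J} (s : G ⨯ A ⟶ B) :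
    ∃ (N : Over J) (q : G ⟶ N), LiftsElements P q.left ∧
      ∀ {T : E} (t₁ t₂ : T ⟶ G.left), t₁ ≫ q.left = t₂ ≫ q.left ↔
        t₁ ≫ G.hom = t₂ ≫ G.hom ∧ ∀ {W : E}, P W → ∀ (w : W ⟶ T) (a : W ⟶ A.left)
          (e₁ : (w ≫ t₁) ≫ G.hom = a ≫ A.hom) (e₂ : (w ≫ t₂) ≫ G.hom = a ≫ A.hom),
          overPair (w ≫ t₁) a e₁ ≫ s.left = overPair (w ≫ t₂) a e₂ ≫ s.left := by
  obtain ⟨R, m, hm, hR⟩ := hP.exists_forall_eq hfull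
    (prod.fst : (G ⨯ G) ⨯ A ⟶ G ⨯ G).left
    (prod.map prod.fst (𝟙 A) ≫ s).left (prod.map prod.snd (𝟙 A) ≫ s).left
  let r₁ : R ⟶ G.left := m ≫ (prod.fst : G ⨯ G ⟶ G).left
  let r₂ : R ⟶ G.left := m ≫ (prod.snd : G ⨯ G ⟶ G).left
  have hr : ∀ {T : E} (t₁ t₂ : T ⟶ G.left), (∃ l : T ⟶ R, l ≫ r₁ = t₁ ∧ l ≫ r₂ = t₂) ↔
        t₁ ≫ G.hom = t₂ ≫ G.hom ∧ ∀ {W : E}, P W → ∀ (w : W ⟶ T) (a : W ⟶ A.left)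
          (e₁ : (w ≫ t₁) ≫ G.hom = a ≫ A.hom) (e₂ : (w ≫ t₂) ≫ G.hom = a ≫ A.hom),
          overPair (w ≫ t₁) a e₁ ≫ s.left = overPair (w ≫ t₂) a e₂ ≫ s.left := by
    intro T t₁ t₂
    constructor
    · rintro ⟨l, rfl, rfl⟩
      refine ⟨by simp [r₁, r₂], fun {W} hW w a e₁ e₂ => ?_⟩
      have := (hR (l ≫ m)).1 ⟨l, rfl⟩ hW w (overPair (w ≫ l ≫ m) a (by
        simpa [r₁] using e₁)) (by simp)
      simp only [Over.comp_left, ← Category.assoc, overPair_map] at this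
      simpa only [r₁, r₂, Category.assoc] using this
    · rintro ⟨h, h'⟩
      obtain ⟨l, hl⟩ := (hR (overPair t₁ t₂ h)).2 (by
        intro W hW w v hv
        obtain ⟨z, a, e, rfl⟩ := exists_eq_overPair v
        rw [overPair_fst] at hv
        subst hv
        have := h' hW w a (by simpa [overPair_hom] using e)
          (by simpa [overPair_hom, h] using e)
        simp only [Over.comp_left, ← Category.assoc, overPair_map]
        simpa only [Category.assoc, overPair_fst, overPair_snd] using this)
      exact ⟨l, by simp [r₁, reassoc_of% hl], by simp [r₂, reassoc_of% hl]⟩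
  obtain ⟨Y, q₀, hq₀⟩ := ExactCategory.equivRelEffective r₁ r₂ (by
    refine ⟨fun a b h₁ h₂ => ?_, fun x => (hr x x).2 ⟨rfl, fun _ _ _ _ _ => rfl⟩,
      fun a => ?_, fun a b hab => ?_⟩
    · rw [← cancel_mono m]
      exact overProd_hom_ext (by simpa [r₁] using h₁) (by simpa [r₂] using h₂)
    · obtain ⟨h, h'⟩ := (hr (a ≫ r₁) (a ≫ r₂)).1 ⟨a, rfl, rfl⟩
      exact (hr _ _).2 ⟨h.symm, fun hW w c e₁ e₂ => (h' hW w c e₂ e₁).symm⟩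
    · obtain ⟨h₁, h₁'⟩ := (hr (a ≫ r₁) (a ≫ r₂)).1 ⟨a, rfl, rfl⟩
      obtain ⟨h₂, h₂'⟩ := (hr (a ≫ r₂) (b ≫ r₂)).1 ⟨b, hab.symm, rfl⟩
      refine (hr _ _).2 ⟨h₁.trans h₂, fun hW w c e₁ e₂ => ?_⟩
      have e : (w ≫ a ≫ r₂) ≫ G.hom = c ≫ A.hom := by
        rw [Category.assoc, ← h₁, ← Category.assoc, e₁]
      exact (h₁' hW w c e₁ e).trans (h₂' hW w c e e₂))
  obtain ⟨I, q, i, hq, hi, rfl⟩ := hP.exists_image q₀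
  have hker : ∀ {T : E} (t₁ t₂ : T ⟶ G.left), t₁ ≫ q = t₂ ≫ q ↔
      ∃ l : T ⟶ R, l ≫ r₁ = t₁ ∧ l ≫ r₂ = t₂ := by
    intro T t₁ t₂
    constructor
    · intro h
      exact hq₀.exists_lift t₁ t₂ (by simp only [reassoc_of% h])
    · rintro ⟨l, rfl, rfl⟩
      rw [← cancel_mono i]
      simp [hq₀.w]
  obtain ⟨n, hn⟩ := hP.exists_desc hq G.hom fun hW a a' h =>
    ((hr a a').1 ((hker a a').1 h)).1
  exact ⟨Over.mk n, Over.homMk q hn, hq, fun t₁ t₂ => (hker t₁ t₂).trans (hr t₁ t₂)⟩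

theorem IsProjectiveCover.exists_isExponential (hP : IsProjectiveCover P)
    (hfull : HasDepFullDiagramsOn P) (A B : Over J) :
    ∃ (N : Over J) (ev : N ⨯ A ⟶ B), IsExponential A B N ev := by
  obtain ⟨G, s, hs⟩ := hP.exists_isWeaklyGeneric hfull A B
  obtain ⟨N, q, hq, hker⟩ := hP.exists_extensional_quotient hfull s
  have lifts_map : ∀ {Z Z' : Over J} (c : Z' ⟶ Z), LiftsElements P c.left →
      LiftsElements P (prod.map c (𝟙 A)).left := by
    intro Z Z' c hc W hW b
    obtain ⟨w, a, e, rfl⟩ := exists_eq_overPair b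
    obtain ⟨w', rfl⟩ := hc hW w
    exact ⟨overPair w' a (by simpa using e), overPair_map _ _ _ _⟩
  obtain ⟨ev₀, hev₀⟩ := hP.exists_desc (lifts_map q hq) s.left (by
    intro W hW b b' h
    obtain ⟨w, a, e, rfl⟩ := exists_eq_overPair b
    obtain ⟨w', a', e', rfl⟩ := exists_eq_overPair b'
    rw [overPair_map, overPair_map] at h
    obtain rfl : a = a' := by simpa using h =≫ (prod.snd : N ⨯ A ⟶ A).left
    have hww : w ≫ q.left = w' ≫ q.left := by
      simpa using h =≫ (prod.fst : N ⨯ A ⟶ N).left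
    simpa using ((hker w w').1 hww).2 hW (𝟙 _) a (by simpa using e) (by simpa using e'))
  let ev : N ⨯ A ⟶ B := Over.homMk ev₀ (hP.hom_ext fun {W} hW b => by
    obtain ⟨r, rfl⟩ := lifts_map q hq hW b
    rw [Category.assoc, Category.assoc, reassoc_of% hev₀, Over.w, Over.w])
  have hev : prod.map q (𝟙 A) ≫ ev = s := by
    ext
    exact hev₀
  have ev_elt : ∀ {W : E} (w : W ⟶ G.left) (a : W ⟶ A.left) (e : w ≫ G.hom = a ≫ A.hom)
      (z : W ⟶ N.left) (e' : z ≫ N.hom = a ≫ A.hom), w ≫ q.left = z →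
      overPair z a e' ≫ ev.left = overPair w a e ≫ s.left := by
    rintro W w a e _ e' rfl
    rw [← hev, Over.comp_left, ← Category.assoc, overPair_map]
  refine ⟨N, ev, fun {Z} g => ?_⟩
  obtain ⟨X, c, hX, hc⟩ := hP.exists_cover Z.left
  let Z' : Over J := Over.mk (c ≫ Z.hom)
  let c' : Z' ⟶ Z := Over.homMk c
  obtain ⟨h', hh'⟩ := hs (Z := Z') hX (prod.map c' (𝟙 A) ≫ g)
  have s_elt : ∀ {W : E} (w : W ⟶ X) (a : W ⟶ A.left) (e : (w ≫ h'.left) ≫ G.hom = a ≫ A.hom)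
      (z : W ⟶ Z.left) (e' : z ≫ Z.hom = a ≫ A.hom), w ≫ c = z →
      overPair (w ≫ h'.left) a e ≫ s.left = overPair z a e' ≫ g.left := by
    rintro W w a e _ e' rfl
    have := congrArg (fun k => overPair (Z := Z') w a (by simpa [Z'] using e') ≫ k.left) hh'
    simp only [Over.comp_left, ← Category.assoc, overPair_map] at this
    exact this
  have hh'J : h'.left ≫ G.hom = c ≫ Z.hom := Over.w h'
  obtain ⟨h₀, hh₀⟩ := hP.exists_desc hc (h'.left ≫ q.left) (by
    intro W hW a a' haa
    simp only [← Category.assoc]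
    refine (hker _ _).2 ⟨by simp only [Category.assoc, hh'J, reassoc_of% haa], ?_⟩
    intro W' hW' w b e₁ e₂
    have e : (w ≫ a ≫ c) ≫ Z.hom = b ≫ A.hom := by
      simpa [hh'J] using e₁
    have h₁ := s_elt (w ≫ a) b (by simpa using e₁) _ e (by simp)
    have h₂ := s_elt (w ≫ a') b (by simpa using e₂) _ e (by simp [haa])
    simpa using h₁.trans h₂.symm)
  let h : Z ⟶ N := Over.homMk h₀ (hP.hom_ext fun {W} hW z => by
    obtain ⟨z, rfl⟩ := hc hW z
    rw [Category.assoc, reassoc_of% hh₀, Over.w, hh'J, Category.assoc])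
  refine ⟨h, ?_, ?_⟩
  · refine hP.over_hom_ext fun {W} hW z a e => ?_
    obtain ⟨w, rfl⟩ := hc hW z
    have e' : (w ≫ h'.left) ≫ G.hom = a ≫ A.hom := by simpa [hh'J] using e
    rw [Over.comp_left, ← Category.assoc, overPair_map, ← s_elt w a e' _ e rfl]
    exact ev_elt _ _ _ _ _ (by simp [h, hh₀])
  · intro k hk
    refine Over.OverMorphism.ext (hP.hom_ext fun {W} hW z => ?_)
    obtain ⟨w, rfl⟩ := hc hW z
    obtain ⟨w', hw'⟩ := hq hW ((w ≫ c) ≫ k.left)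
    have hh : (w ≫ c) ≫ h.left = (w ≫ h'.left) ≫ q.left := by
      simp [h, hh₀]
    have hw'J : w' ≫ G.hom = (w ≫ h'.left) ≫ G.hom := by
      rw [← Over.w q, ← Category.assoc, hw']
      simp [hh'J]
    rw [hh, ← hw']
    refine (hker _ _).2 ⟨hw'J, fun {W'} hW' r b e₁ e₂ => ?_⟩
    have e : (r ≫ w ≫ c) ≫ Z.hom = b ≫ A.hom := by
      simpa [hh'J] using e₂
    have h₁ := s_elt (r ≫ w) b (by simpa using e₂) _ e (by simp)
    have h₂ := ev_elt (r ≫ w') b e₁ ((r ≫ w ≫ c) ≫ k.left) (by simpa using e) (by simp [hw'])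
    rw [← h₂, ← overPair_map k _ _ e, Category.assoc, ← Over.comp_left, hk, ← h₁]
    simp

end Exponential

/-- If a projective cover `P` of an exact category `E` has
dependent full diagrams, then `E` is locally cartesian closed. -/
theorem exact_locallyCartesianClosed_of_depFullDiagrams
    {E : Type u} [Category.{v} E] [ExactCategory E]
    (P : E → Prop) (hP : IsProjectiveCover P)
    (hfull : HasDepFullDiagramsOn P) :
    IsLocallyCartesianClosed E :=
  fun _ A B => hP.exists_isExponential hfull A B

end Paper
end

section
/- Let M be a model category and let A and B be cofibrant objects. Then every commutative square g k = l f, where f : A → B is a weak equivalence, g : C → D is a fibration, k : A → C and l : B → D, has a homotopy diagonal filler: a morphism d : B → C with g d = l and d f fibrewise right homotopic to k over g. Moreover, any two such homotopy diagonal fillers are fibrewise right homotopic over g. -/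
open CategoryTheory CategoryTheory.Limits

universe v u v₂ u₂

namespace Paper

variable {M : Type u} [Category.{v} M]

/-- `(L, R)` is a weak factorisation system: every morphism factors as an
`L`-map followed by an `R`-map, and each class is characterised by the
lifting property against the other. -/
def IsWFS (L R : MorphismProperty M) : Prop :=
  (∀ {A B : M} (f : A ⟶ B),
    ∃ (Z : M) (i : A ⟶ Z) (p : Z ⟶ B), L i ∧ R p ∧ i ≫ p = f) ∧
  (∀ {A B : M} (i : A ⟶ B),
    L i ↔ ∀ {X Y : M} (p : X ⟶ Y), R p → HasLiftingProperty i p) ∧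
  (∀ {X Y : M} (p : X ⟶ Y),
    R p ↔ ∀ {A B : M} (i : A ⟶ B), L i → HasLiftingProperty i p)

/-- A Quillen model structure on a bicomplete category: weak equivalences
satisfying 2-out-of-3, and two weak factorisation systems
(cofibrations, acyclic fibrations) and (acyclic cofibrations, fibrations). -/
structure ModelStructure (M : Type u) [Category.{v} M]
    [HasLimits M] [HasColimits M] where
  W : MorphismProperty M
  Fib : MorphismProperty M
  Cof : MorphismProperty M
  w_two_out_of_three :
    ∀ {X Y Z : M} (f : X ⟶ Y) (g : Y ⟶ Z),
      (W f → W g → W (f ≫ g)) ∧ (W (f ≫ g) → W f → W g) ∧ (W (f ≫ g) → W g → W f)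
  wfs_cof_acycFib : IsWFS Cof (fun {_ _} f => W f ∧ Fib f)
  wfs_acycCof_fib : IsWFS (fun {_ _} f => W f ∧ Cof f) Fib

variable [HasLimits M] [HasColimits M]

/-- An object is cofibrant if the map from the initial object is a cofibration. -/
def ModelStructure.Cofibrant (S : ModelStructure M) (A : M) : Prop :=
  S.Cof (initial.to A)

/-- An object is fibrant if the map to the terminal object is a fibration. -/
def ModelStructure.Fibrant (S : ModelStructure M) (A : M) : Prop :=
  S.Fib (terminal.from A)

/-- A model structure is right proper if weak equivalences are stable under
pullback along fibrations. -/
def ModelStructure.RightProper (S : ModelStructure M) : Prop :=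
  ∀ {X Y Z P : M} (f : X ⟶ Z) (g : Y ⟶ Z) (p₁ : P ⟶ X) (p₂ : P ⟶ Y),
    IsPullback p₁ p₂ f g → S.W f → S.Fib g → S.W p₂

end Paper
namespace Paper

variable {C : Type u} [Category.{v} C]

/-- A fibrewise path object for `g : B ⟶ A` with respect to classes `Weq` of weak
equivalences and `Fib` of fibrations: a factorisation of the fibrewise diagonal
`B ⟶ B ×_A B` into a weak equivalence followed by a fibration. -/
structure FibPathObj (Weq Fib : MorphismProperty C) {B A : C} (g : B ⟶ A) where
  P : C
  r : B ⟶ P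
  π₁ : P ⟶ B
  π₂ : P ⟶ B
  weq_r : Weq r
  w : π₁ ≫ g = π₂ ≫ g
  r_π₁ : r ≫ π₁ = 𝟙 B
  r_π₂ : r ≫ π₂ = 𝟙 B
  fib : ∀ {Q : C} (q₁ q₂ : Q ⟶ B), IsPullback q₁ q₂ g g →
    ∀ t : P ⟶ Q, t ≫ q₁ = π₁ → t ≫ q₂ = π₂ → Fib t

/-- `k` and `k'` are fibrewise (right) homotopic over `g`. -/
def FibrewiseHomotopic (Weq Fib : MorphismProperty C) {X B A : C} (g : B ⟶ A)
    (k k' : X ⟶ B) : Prop :=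
  ∃ (po : FibPathObj Weq Fib g) (H : X ⟶ po.P), H ≫ po.π₁ = k ∧ H ≫ po.π₂ = k'

/-- Two maps are (right) homotopic if they are fibrewise homotopic over the
terminal map. -/
def Homotopic (Weq Fib : MorphismProperty C) [HasTerminal C] {X B : C}
    (k k' : X ⟶ B) : Prop :=
  FibrewiseHomotopic Weq Fib (terminal.from B) k k'

/-- A homotopy equivalence. -/
def IsHomotopyEquiv (Weq Fib : MorphismProperty C) [HasTerminal C] {A B : C}
    (h : A ⟶ B) : Prop :=
  ∃ k : B ⟶ A, Homotopic Weq Fib (h ≫ k) (𝟙 A) ∧ Homotopic Weq Fib (k ≫ h) (𝟙 B)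

/-- The square `(q₁, q₂)` over `f, g` (commuting up to homotopy) is a homotopy
pullback: the comparison map into the standard homotopy pullback
`X ×_Z PZ ×_Z Y` is a homotopy equivalence. -/
def IsHomotopyPullback (Weq Fib : MorphismProperty C) [HasTerminal C]
    {X Y Z Q : C} (f : X ⟶ Z) (g : Y ⟶ Z) (q₁ : Q ⟶ X) (q₂ : Q ⟶ Y) : Prop :=
  ∃ (po : FibPathObj Weq Fib (terminal.from Z)) (W : C)
      (a : W ⟶ X) (b : W ⟶ Y) (c : W ⟶ po.P),
    c ≫ po.π₁ = a ≫ f ∧ c ≫ po.π₂ = b ≫ g ∧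
    (∀ {V : C} (a' : V ⟶ X) (b' : V ⟶ Y) (c' : V ⟶ po.P),
      c' ≫ po.π₁ = a' ≫ f → c' ≫ po.π₂ = b' ≫ g →
        ∃! t : V ⟶ W, t ≫ a = a' ∧ t ≫ b = b' ∧ t ≫ c = c') ∧
    ∃ h : Q ⟶ po.P, h ≫ po.π₁ = q₁ ≫ f ∧ h ≫ po.π₂ = q₂ ≫ g ∧
      ∀ t : Q ⟶ W, t ≫ a = q₁ → t ≫ b = q₂ → t ≫ c = h → IsHomotopyEquiv Weq Fib t

/-- A homotopy weak dependent product (weak homotopy Π-type) of the fibrations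
`f : A ⟶ I` and `g : B ⟶ A`. -/
def IsHomotopyWeakDepProd (Weq Fib : MorphismProperty C) {I A B U V : C}
    (f : A ⟶ I) (g : B ⟶ A)
    (u : U ⟶ I) (p₁ : V ⟶ U) (p₂ : V ⟶ A) (e : V ⟶ B) : Prop :=
  Fib u ∧ IsPullback p₁ p₂ u f ∧ e ≫ g = p₂ ∧
    ∀ {U' V' : C} (u' : U' ⟶ I) (p₁' : V' ⟶ U') (p₂' : V' ⟶ A) (e' : V' ⟶ B),
      IsPullback p₁' p₂' u' f → e' ≫ g = p₂' →
        ∃ k : U' ⟶ U, k ≫ u = u' ∧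
          ∀ m : V' ⟶ V, m ≫ p₁ = p₁' ≫ k → m ≫ p₂ = p₂' →
            FibrewiseHomotopic Weq Fib g (m ≫ e) e'

end Paper
namespace Paper

section

variable {M : Type u} [Category.{v} M]

theorem IsWFS.eq_rlp {L R : MorphismProperty M} (h : IsWFS L R) : R = L.rlp := by
  ext X Y p
  exact ⟨fun hp _ _ i hi => (h.2.2 p).1 hp i hi, fun hp => (h.2.2 p).2 fun i hi => hp i hi⟩

theorem IsWFS.isMultiplicative {L R : MorphismProperty M} (h : IsWFS L R) :
    R.IsMultiplicative := by
  rw [h.eq_rlp]; infer_instance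

theorem IsWFS.isStableUnderBaseChange {L R : MorphismProperty M} (h : IsWFS L R) :
    R.IsStableUnderBaseChange := by
  rw [h.eq_rlp]; infer_instance

theorem FibPathObj.fib_lift {Weq Fib : MorphismProperty M} {X Y : M} {g : X ⟶ Y}
    [HasPullback g g] (po : FibPathObj Weq Fib g) :
    Fib (pullback.lift po.π₁ po.π₂ po.w) :=
  po.fib _ _ (IsPullback.of_hasPullback g g) _
    (pullback.lift_fst _ _ _) (pullback.lift_snd _ _ _)

variable [HasLimits M] [HasColimits M] (S : ModelStructure M)

namespace ModelStructure

instance : S.Fib.IsMultiplicative := S.wfs_acycCof_fib.isMultiplicative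

instance : S.Fib.IsStableUnderBaseChange := S.wfs_acycCof_fib.isStableUnderBaseChange

theorem id_w (X : M) : S.W (𝟙 X) :=
  ((S.wfs_acycCof_fib.2.1 (𝟙 X)).2 fun _ _ => inferInstance).1

variable {S}

theorem acycFib_of_isPullback {P X Y Z : M} {p₁ : P ⟶ X} {p₂ : P ⟶ Y} {f : X ⟶ Z} {g : Y ⟶ Z}
    (h : IsPullback p₁ p₂ f g) (hgW : S.W g) (hgF : S.Fib g) : S.W p₁ ∧ S.Fib p₁ :=
  S.wfs_cof_acycFib.isStableUnderBaseChange.of_isPullback h.flip ⟨hgW, hgF⟩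

theorem Cofibrant.exists_lift {A : M} (hA : S.Cofibrant A) {E B : M} {p : E ⟶ B}
    (hW : S.W p) (hF : S.Fib p) (b : A ⟶ B) : ∃ e : A ⟶ E, e ≫ p = b := by
  have : HasLiftingProperty (initial.to A) p := (S.wfs_cof_acycFib.2.1 _).1 hA p ⟨hW, hF⟩
  have sq : CommSq (initial.to E) (initial.to A) p b := ⟨by ext⟩
  exact ⟨sq.lift, sq.fac_right⟩

variable (S)

/-- Every weak equivalence is an acyclic cofibration followed by an acyclic fibration. -/
theorem exists_acycCof_acycFib {A B : M} (f : A ⟶ B) (hf : S.W f) :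
    ∃ (Z : M) (i : A ⟶ Z) (p : Z ⟶ B),
      (S.W i ∧ S.Cof i) ∧ (S.W p ∧ S.Fib p) ∧ i ≫ p = f := by
  obtain ⟨Z, i, p, hi, hp, rfl⟩ := S.wfs_cof_acycFib.1 f
  exact ⟨Z, i, p, ⟨(S.w_two_out_of_three i p).2.2 hf hp.1, hi⟩, hp, rfl⟩

theorem nonempty_fibPathObj {X Y : M} (g : X ⟶ Y) : Nonempty (FibPathObj S.W S.Fib g) := by
  obtain ⟨P, r, c, hr, hc, fac⟩ := S.wfs_acycCof_fib.1 (pullback.diagonal g)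
  refine ⟨⟨P, r, c ≫ pullback.fst g g, c ≫ pullback.snd g g, hr.1, ?_, ?_, ?_, ?_⟩⟩
  · simp [pullback.condition]
  · simp [reassoc_of% fac]
  · simp [reassoc_of% fac]
  · intro Q q₁ q₂ hQ t ht₁ ht₂
    have ht : t = c ≫ (hQ.isoPullback).inv := by
      apply hQ.hom_ext <;> simp [ht₁, ht₂]
    rw [ht]
    exact S.Fib.comp_mem _ _ hc (MorphismProperty.of_isIso _ _)

variable {S}

theorem acycFib_π₂ {X Y : M} {g : X ⟶ Y} (hg : S.Fib g) (po : FibPathObj S.W S.Fib g) :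
    S.W po.π₂ ∧ S.Fib po.π₂ := by
  refine ⟨(S.w_two_out_of_three po.r po.π₂).2.1 (by rw [po.r_π₂]; exact S.id_w X) po.weq_r, ?_⟩
  rw [← pullback.lift_snd po.π₁ po.π₂ po.w]
  exact S.Fib.comp_mem _ _ po.fib_lift (S.Fib.pullback_snd _ _ hg)

variable (S)

/-- Two maps over `Y` out of `Q` that agree on a weak equivalence into `Q` become fibrewise
homotopic on cofibrant objects over `Q`. -/
theorem exists_homotopy_of_weq {A Q Z X Y : M} (hA : S.Cofibrant A) {t : Z ⟶ Q} (ht : S.W t)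
    {g : X ⟶ Y} (po : FibPathObj S.W S.Fib g) {u v : Q ⟶ X}
    (huv : u ≫ g = v ≫ g) (htuv : t ≫ u = t ≫ v) (a : A ⟶ Q) :
    ∃ H : A ⟶ po.P, H ≫ po.π₁ = a ≫ u ∧ H ≫ po.π₂ = a ≫ v := by
  obtain ⟨Q', j, q, hj, hq, rfl⟩ := S.exists_acycCof_acycFib t ht
  obtain ⟨a', rfl⟩ := hA.exists_lift hq.1 hq.2 a
  have : HasLiftingProperty j (pullback.lift po.π₁ po.π₂ po.w) :=
    (S.wfs_acycCof_fib.2.1 j).1 hj _ po.fib_lift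
  have sq : CommSq (j ≫ q ≫ u ≫ po.r) j (pullback.lift po.π₁ po.π₂ po.w)
      (pullback.lift (q ≫ u) (q ≫ v) (by simp [huv])) :=
    ⟨by
      ext
      · simp [po.r_π₁, pullback.lift_fst]
      · simpa [po.r_π₂, pullback.lift_snd] using htuv⟩
  refine ⟨a' ≫ sq.lift, ?_, ?_⟩
  · have h := sq.fac_right =≫ pullback.fst g g
    rw [Category.assoc, pullback.lift_fst, pullback.lift_fst] at h
    simp [h]
  · have h := sq.fac_right =≫ pullback.snd g g
    rw [Category.assoc, pullback.lift_snd, pullback.lift_snd] at h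
    simp [h]

/-- A homotopy diagonal filler exists, with the homotopy in any given path object. -/
theorem exists_homotopy_filler {A B X Y : M} (hA : S.Cofibrant A) (hB : S.Cofibrant B)
    (f : A ⟶ B) (hf : S.W f) (g : X ⟶ Y) (hg : S.Fib g)
    (k : A ⟶ X) (l : B ⟶ Y) (sq : k ≫ g = f ≫ l) (po : FibPathObj S.W S.Fib g) :
    ∃ d : B ⟶ X, d ≫ g = l ∧ ∃ H : A ⟶ po.P, H ≫ po.π₁ = f ≫ d ∧ H ≫ po.π₂ = k := by
  obtain ⟨Z, i, p, hi, hp, rfl⟩ := S.exists_acycCof_acycFib f hf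
  have : HasLiftingProperty i g := (S.wfs_acycCof_fib.2.1 i).1 hi g hg
  have sq' : CommSq k i g (p ≫ l) := ⟨by simpa using sq⟩
  obtain ⟨s, hs⟩ := hB.exists_lift hp.1 hp.2 (𝟙 B)
  refine ⟨s ≫ sq'.lift, by simp [reassoc_of% hs], ?_⟩
  have hdiag : S.W (pullback.diagonal p) :=
    (S.w_two_out_of_three _ (pullback.fst p p)).2.2
      (by rw [pullback.diagonal_fst]; exact S.id_w Z)
      (acycFib_of_isPullback (IsPullback.of_hasPullback p p) hp.1 hp.2).1
  obtain ⟨H, h₁, h₂⟩ := S.exists_homotopy_of_weq hA hdiag po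
    (u := pullback.fst p p ≫ sq'.lift) (v := pullback.snd p p ≫ sq'.lift)
    (by simp [pullback.condition_assoc]) (by simp)
    (pullback.lift (i ≫ p ≫ s) i (by simp [hs]))
  rw [pullback.lift_fst_assoc] at h₁
  rw [pullback.lift_snd_assoc] at h₂
  exact ⟨H, by simpa using h₁, by simpa using h₂⟩

/-- Maps out of a cofibrant object that are fibrewise homotopic to a common map are homotopic
through any given path object. -/
theorem exists_homotopy_of_common_target {A X Y : M} (hA : S.Cofibrant A) {g : X ⟶ Y}
    (hg : S.Fib g) {a b c : A ⟶ X} (hac : FibrewiseHomotopic S.W S.Fib g a c)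
    (hbc : FibrewiseHomotopic S.W S.Fib g b c) (po : FibPathObj S.W S.Fib g) :
    ∃ H : A ⟶ po.P, H ≫ po.π₁ = a ∧ H ≫ po.π₂ = b := by
  obtain ⟨P, H, rfl, rfl⟩ := hac
  obtain ⟨P', H', rfl, hc⟩ := hbc
  have hfst := acycFib_of_isPullback (IsPullback.of_hasPullback P.π₂ P'.π₂)
    (acycFib_π₂ hg P').1 (acycFib_π₂ hg P').2
  have ht : S.W (pullback.lift P.r P'.r (P.r_π₂.trans P'.r_π₂.symm)) :=
    (S.w_two_out_of_three _ (pullback.fst P.π₂ P'.π₂)).2.2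
      (by rw [pullback.lift_fst]; exact P.weq_r) hfst.1
  simpa [pullback.lift_fst_assoc, pullback.lift_snd_assoc] using S.exists_homotopy_of_weq hA ht po
    (u := pullback.fst P.π₂ P'.π₂ ≫ P.π₁) (v := pullback.snd P.π₂ P'.π₂ ≫ P'.π₁)
    (by simp [P.w, P'.w, pullback.condition_assoc])
    (by simp [P.r_π₁, P'.r_π₁, pullback.lift_fst_assoc, pullback.lift_snd_assoc])
    (pullback.lift H H' hc.symm)

end ModelStructure

end

/-- In a model category, every commutative square whose left
edge is a weak equivalence between cofibrant objects and whose right edge is a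
fibration admits a homotopy diagonal filler, unique up to fibrewise homotopy. -/
theorem homotopy_diagonal_filler
    {M : Type u} [Category.{v} M] [HasLimits M] [HasColimits M]
    (S : ModelStructure M) {A B X Y : M}
    (hA : S.Cofibrant A) (hB : S.Cofibrant B)
    (f : A ⟶ B) (hf : S.W f) (g : X ⟶ Y) (hg : S.Fib g)
    (k : A ⟶ X) (l : B ⟶ Y) (sq : k ≫ g = f ≫ l) :
    (∃ d : B ⟶ X, d ≫ g = l ∧ FibrewiseHomotopic S.W S.Fib g (f ≫ d) k) ∧
    (∀ d d' : B ⟶ X,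
      d ≫ g = l → FibrewiseHomotopic S.W S.Fib g (f ≫ d) k →
      d' ≫ g = l → FibrewiseHomotopic S.W S.Fib g (f ≫ d') k →
      FibrewiseHomotopic S.W S.Fib g d d') := by
  obtain ⟨po⟩ := S.nonempty_fibPathObj g
  refine ⟨?_, fun d d' hd hk hd' hk' => ?_⟩
  · obtain ⟨d, hd, h⟩ := S.exists_homotopy_filler hA hB f hf g hg k l sq po
    exact ⟨d, hd, po, h⟩
  · obtain ⟨H, hH₁, hH₂⟩ := S.exists_homotopy_of_common_target hA hg hk hk' po
    obtain ⟨p'⟩ := S.nonempty_fibPathObj (pullback.lift po.π₁ po.π₂ po.w)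
    obtain ⟨D, hD, -⟩ := S.exists_homotopy_filler hA hB f hf _ po.fib_lift H
      (pullback.lift d d' (hd.trans hd'.symm))
      (by ext <;> simp [hH₁, hH₂, pullback.lift_fst, pullback.lift_snd]) p'
    refine ⟨po, D, ?_, ?_⟩
    · simpa only [Category.assoc, pullback.lift_fst] using hD =≫ pullback.fst g g
    · simpa only [Category.assoc, pullback.lift_snd] using hD =≫ pullback.snd g g

end Paper
end

section
/- Let C be a path category and let f : A → I and g : B → A be fibrations. Then every homotopy weak dependent product of f and g is a homotopy full diagram over f, g. -/
open CategoryTheory CategoryTheory.Limits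

universe v u v₂ u₂

namespace Paper

variable {C : Type u} [Category.{v} C]

/-- A path category (category of fibrant objects in which every acyclic
fibration has a section), à la van den Berg–Moerdijk. -/
structure PathCatStruct (C : Type u) [Category.{v} C] [HasTerminal C] where
  Fib : MorphismProperty C
  Weq : MorphismProperty C
  fib_iso : ∀ {X Y : C} (f : X ⟶ Y), IsIso f → Fib f
  weq_iso : ∀ {X Y : C} (f : X ⟶ Y), IsIso f → Weq f
  fib_comp : ∀ {X Y Z : C} (f : X ⟶ Y) (g : Y ⟶ Z), Fib f → Fib g → Fib (f ≫ g)
  weq_comp : ∀ {X Y Z : C} (f : X ⟶ Y) (g : Y ⟶ Z), Weq f → Weq g → Weq (f ≫ g)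
  weq_two_out_of_six : ∀ {X Y Z T : C} (f : X ⟶ Y) (g : Y ⟶ Z) (h : Z ⟶ T),
    Weq (f ≫ g) → Weq (g ≫ h) →
      Weq f ∧ Weq g ∧ Weq h ∧ Weq (f ≫ g ≫ h)
  fib_terminal : ∀ X : C, Fib (terminal.from X)
  pullback_exists : ∀ {X Y Z : C} (f : X ⟶ Z) (g : Y ⟶ Z), Fib g →
    ∃ (P : C) (p₁ : P ⟶ X) (p₂ : P ⟶ Y), IsPullback p₁ p₂ f g
  fib_stable : ∀ {X Y Z P : C} (f : X ⟶ Z) (g : Y ⟶ Z) (p₁ : P ⟶ X) (p₂ : P ⟶ Y),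
    IsPullback p₁ p₂ f g → Fib g → Fib p₁
  acyc_fib_stable : ∀ {X Y Z P : C} (f : X ⟶ Z) (g : Y ⟶ Z) (p₁ : P ⟶ X) (p₂ : P ⟶ Y),
    IsPullback p₁ p₂ f g → Fib g → Weq g → Weq p₁
  acyc_fib_section : ∀ {X Y : C} (f : X ⟶ Y), Fib f → Weq f →
    ∃ s : Y ⟶ X, s ≫ f = 𝟙 Y
  path_obj : ∀ X : C, Nonempty (FibPathObj Weq Fib (terminal.from X))

/-- A homotopy full diagram over `f : A ⟶ I`, `g : B ⟶ A`. -/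
def IsHomotopyFullDiagram (Weq Fib : MorphismProperty C) [HasTerminal C]
    {I A B U V : C} (f : A ⟶ I) (g : B ⟶ A)
    (u : U ⟶ I) (p₁ : V ⟶ U) (p₂ : V ⟶ A) (e : V ⟶ B) : Prop :=
  Homotopic Weq Fib (p₁ ≫ u) (p₂ ≫ f) ∧
  IsHomotopyPullback Weq Fib u f p₁ p₂ ∧
  Homotopic Weq Fib (e ≫ g) p₂ ∧
    ∀ {U' V' : C} (u' : U' ⟶ I) (p₁' : V' ⟶ U') (p₂' : V' ⟶ A) (e' : V' ⟶ B),
      Homotopic Weq Fib (p₁' ≫ u') (p₂' ≫ f) →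
      IsHomotopyPullback Weq Fib u' f p₁' p₂' →
      Homotopic Weq Fib (e' ≫ g) p₂' →
        ∃ h : U' ⟶ U, Homotopic Weq Fib (h ≫ u) u' ∧
          ∃ (P : C) (q₁ : P ⟶ V) (q₂ : P ⟶ U'),
            Homotopic Weq Fib (q₁ ≫ p₁) (q₂ ≫ h) ∧
            IsHomotopyPullback Weq Fib p₁ h q₁ q₂ ∧
            ∃ k : P ⟶ V', Homotopic Weq Fib (k ≫ p₁') q₂ ∧
              Homotopic Weq Fib (k ≫ e') (q₁ ≫ e)

end Paper
namespace Paper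

variable {C : Type u} [Category.{v} C]

theorem isPullback_of_exists_unique {P X Y Z : C} {p₁ : P ⟶ X} {p₂ : P ⟶ Y} {f : X ⟶ Z}
    {g : Y ⟶ Z} (w : p₁ ≫ f = p₂ ≫ g)
    (ex : ∀ {W : C} (a : W ⟶ X) (b : W ⟶ Y), a ≫ f = b ≫ g →
      ∃ t : W ⟶ P, t ≫ p₁ = a ∧ t ≫ p₂ = b)
    (uniq : ∀ {W : C} (s t : W ⟶ P), s ≫ p₁ = t ≫ p₁ → s ≫ p₂ = t ≫ p₂ → s = t) :
    IsPullback p₁ p₂ f g := by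
  refine ⟨⟨w⟩, ⟨PullbackCone.IsLimit.mk w
    (fun s => (ex s.fst s.snd s.condition).choose)
    (fun s => (ex s.fst s.snd s.condition).choose_spec.1)
    (fun s => (ex s.fst s.snd s.condition).choose_spec.2) ?_⟩⟩
  intro s m h₁ h₂
  have h := (ex s.fst s.snd s.condition).choose_spec
  exact uniq _ _ (h₁.trans h.1.symm) (h₂.trans h.2.symm)

theorem FibrewiseHomotopic.precomp {Weq Fib : MorphismProperty C} {T X E B : C} {p : E ⟶ B}
    {α β : X ⟶ E} (h : FibrewiseHomotopic Weq Fib p α β) (t : T ⟶ X) :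
    FibrewiseHomotopic Weq Fib p (t ≫ α) (t ≫ β) := by
  obtain ⟨po, H, rfl, rfl⟩ := h
  exact ⟨po, t ≫ H, Category.assoc .., Category.assoc ..⟩

/-- A fibrewise path object read backwards. -/
def FibPathObj.swap {Weq Fib : MorphismProperty C} {B A : C} {g : B ⟶ A}
    (po : FibPathObj Weq Fib g) : FibPathObj Weq Fib g where
  P := po.P
  r := po.r
  π₁ := po.π₂
  π₂ := po.π₁
  weq_r := po.weq_r
  w := po.w.symm
  r_π₁ := po.r_π₂
  r_π₂ := po.r_π₁
  fib q₁ q₂ h t h₁ h₂ := po.fib q₂ q₁ h.flip t h₂ h₁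

theorem FibrewiseHomotopic.symm {Weq Fib : MorphismProperty C} {X E B : C} {p : E ⟶ B}
    {α β : X ⟶ E} (h : FibrewiseHomotopic Weq Fib p α β) :
    FibrewiseHomotopic Weq Fib p β α := by
  obtain ⟨po, H, h₁, h₂⟩ := h
  exact ⟨po.swap, H, h₂, h₁⟩

theorem Homotopic.precomp {Weq Fib : MorphismProperty C} [HasTerminal C] {T X E : C}
    {α β : X ⟶ E} (h : Homotopic Weq Fib α β) (t : T ⟶ X) :
    Homotopic Weq Fib (t ≫ α) (t ≫ β) :=
  FibrewiseHomotopic.precomp h t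

theorem Homotopic.symm {Weq Fib : MorphismProperty C} [HasTerminal C] {X E : C}
    {α β : X ⟶ E} (h : Homotopic Weq Fib α β) : Homotopic Weq Fib β α :=
  FibrewiseHomotopic.symm h

namespace PathCatStruct

variable [HasTerminal C] (S : PathCatStruct C)

theorem weq_id (X : C) : S.Weq (𝟙 X) := S.weq_iso _ inferInstance

theorem weq_of_weq_comp_left {X Y Z : C} {f : X ⟶ Y} {g : Y ⟶ Z} (hf : S.Weq f)
    (hfg : S.Weq (f ≫ g)) : S.Weq g :=
  (S.weq_two_out_of_six (𝟙 X) f g (by simpa using hf) hfg).2.2.1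

theorem weq_of_weq_comp_right {X Y Z : C} {f : X ⟶ Y} {g : Y ⟶ Z} (hg : S.Weq g)
    (hfg : S.Weq (f ≫ g)) : S.Weq f :=
  (S.weq_two_out_of_six f g (𝟙 Z) hfg (by simpa using hg)).1

theorem weq_of_section {X Y : C} {s : X ⟶ Y} {q : Y ⟶ X} (hq : S.Weq q) (h : s ≫ q = 𝟙 X) :
    S.Weq s :=
  S.weq_of_weq_comp_right hq (h ▸ S.weq_id X)

theorem weq_π₁ {B A : C} {g : B ⟶ A} (po : FibPathObj S.Weq S.Fib g) : S.Weq po.π₁ :=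
  S.weq_of_weq_comp_left po.weq_r (po.r_π₁ ▸ S.weq_id B)

theorem fib_π₁ {B A : C} {g : B ⟶ A} (hg : S.Fib g) (po : FibPathObj S.Weq S.Fib g) :
    S.Fib po.π₁ := by
  obtain ⟨Q, q₁, q₂, hQ⟩ := S.pullback_exists g g hg
  have h := S.fib_comp _ _ (po.fib q₁ q₂ hQ (hQ.lift _ _ po.w) (by simp) (by simp))
    (S.fib_stable _ _ _ _ hQ hg)
  rwa [hQ.lift_fst] at h

theorem fib_mappingPath {X Z E : C} {f : X ⟶ Z}
    (po : FibPathObj S.Weq S.Fib (terminal.from Z)) {e₁ : E ⟶ X} {e₂ : E ⟶ po.P}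
    (hE : IsPullback e₁ e₂ f po.π₁) : S.Fib (e₂ ≫ po.π₂) := by
  obtain ⟨Q, q₁, q₂, hQ⟩ := S.pullback_exists (terminal.from Z) (terminal.from Z)
    (S.fib_terminal Z)
  obtain ⟨R, s₁, s₂, hR⟩ := S.pullback_exists (terminal.from X) (terminal.from Z)
    (S.fib_terminal Z)
  let t : po.P ⟶ Q := hQ.lift po.π₁ po.π₂ (Subsingleton.elim _ _)
  have ht : S.Fib t := po.fib q₁ q₂ hQ t (by simp [t]) (by simp [t])
  let n : R ⟶ Q := hQ.lift (s₁ ≫ f) s₂ (Subsingleton.elim _ _)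
  let z : E ⟶ R := hR.lift e₁ (e₂ ≫ po.π₂) (Subsingleton.elim _ _)
  have hz : IsPullback z e₂ n t := by
    refine isPullback_of_exists_unique ?_ ?_ ?_
    · apply hQ.hom_ext <;> simp [z, n, t, hE.w]
    · intro W a b hab
      have h₁ : (a ≫ s₁) ≫ f = b ≫ po.π₁ := by
        simpa [n, t] using congrArg (· ≫ q₁) hab
      have h₂ : a ≫ s₂ = b ≫ po.π₂ := by
        simpa [n, t] using congrArg (· ≫ q₂) hab
      refine ⟨hE.lift (a ≫ s₁) b h₁, ?_, by simp⟩
      apply hR.hom_ext <;> simp [z, h₂]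
    · intro W a b h₁ h₂
      refine hE.hom_ext ?_ h₂
      simpa [z] using congrArg (· ≫ s₁) h₁
  have h := S.fib_comp _ _ (S.fib_stable _ _ _ _ hz ht)
    (S.fib_stable _ _ _ _ hR.flip (S.fib_terminal X))
  rwa [hR.lift_snd] at h

theorem exists_factorisation {X Y : C} (f : X ⟶ Y) :
    ∃ (Z : C) (i : X ⟶ Z) (p : Z ⟶ Y), S.Weq i ∧ S.Fib p ∧ i ≫ p = f := by
  obtain ⟨po⟩ := S.path_obj Y
  have hπ := S.fib_π₁ (S.fib_terminal Y) po
  obtain ⟨Z, z₁, z₂, hZ⟩ := S.pullback_exists f po.π₁ hπ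
  have hz₁ := S.acyc_fib_stable _ _ _ _ hZ hπ (S.weq_π₁ po)
  exact ⟨Z, hZ.lift (𝟙 X) (f ≫ po.r) (by simp [po.r_π₁]), z₂ ≫ po.π₂,
    S.weq_of_section hz₁ (by simp), S.fib_mappingPath po hZ, by simp [po.r_π₂]⟩

theorem nonempty_fibPathObj {B A : C} {g : B ⟶ A} (hg : S.Fib g) :
    Nonempty (FibPathObj S.Weq S.Fib g) := by
  obtain ⟨Q, q₁, q₂, hQ⟩ := S.pullback_exists g g hg
  obtain ⟨P, i, p, hi, hp, hip⟩ := S.exists_factorisation (hQ.lift (𝟙 B) (𝟙 B) rfl)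
  refine ⟨⟨P, i, p ≫ q₁, p ≫ q₂, hi, by simp [hQ.w], ?_, ?_, ?_⟩⟩
  · rw [← Category.assoc, hip, hQ.lift_fst]
  · rw [← Category.assoc, hip, hQ.lift_snd]
  · intro Q' q₁' q₂' hQ' t h₁ h₂
    have ht : t = p ≫ (hQ.isoIsPullback _ _ hQ').hom := by
      apply hQ'.hom_ext <;> simp [h₁, h₂]
    rw [ht]
    exact S.fib_comp _ _ hp (S.fib_iso _ inferInstance)

/-- A commutative square from a weak equivalence to a fibration factors through an acyclic
fibration over the target of the weak equivalence. -/
theorem exists_acyclic_factorisation {X Y E B : C} {w : X ⟶ Y} (hw : S.Weq w) {p : E ⟶ B}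
    (hp : S.Fib p) {m : X ⟶ E} {n : Y ⟶ B} (h : m ≫ p = w ≫ n) :
    ∃ (X' : C) (i : X ⟶ X') (q : X' ⟶ Y) (j : X' ⟶ E),
      S.Fib q ∧ S.Weq q ∧ i ≫ q = w ∧ i ≫ j = m ∧ j ≫ p = q ≫ n := by
  obtain ⟨E', e₁, e₂, hE⟩ := S.pullback_exists n p hp
  obtain ⟨X', i, c, hi, hc, hic⟩ := S.exists_factorisation (hE.lift w m h.symm)
  have hiq : i ≫ c ≫ e₁ = w := by rw [← Category.assoc, hic, hE.lift_fst]
  refine ⟨X', i, c ≫ e₁, c ≫ e₂, S.fib_comp _ _ hc (S.fib_stable _ _ _ _ hE hp),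
    S.weq_of_weq_comp_left hi (hiq ▸ hw), hiq, ?_, by simp [hE.w]⟩
  rw [← Category.assoc, hic, hE.lift_snd]

theorem exists_lower_filler {X Y E B : C} {w : X ⟶ Y} (hw : S.Weq w) {p : E ⟶ B}
    (hp : S.Fib p) {m : X ⟶ E} {n : Y ⟶ B} (h : m ≫ p = w ≫ n) :
    ∃ l : Y ⟶ E, l ≫ p = n := by
  obtain ⟨X', i, q, j, hq, hq', -, -, hj⟩ := S.exists_acyclic_factorisation hw hp h
  obtain ⟨s, hs⟩ := S.acyc_fib_section q hq hq'
  exact ⟨s ≫ j, by rw [Category.assoc, hj, ← Category.assoc, hs, Category.id_comp]⟩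

theorem exists_homotopy_of_weq {X Y E B : C} {w : X ⟶ Y} (hw : S.Weq w) {p : E ⟶ B}
    (hp : S.Fib p) (po : FibPathObj S.Weq S.Fib p) {α β : Y ⟶ E} (hαβ : α ≫ p = β ≫ p)
    (H : X ⟶ po.P) (h₁ : H ≫ po.π₁ = w ≫ α) (h₂ : H ≫ po.π₂ = w ≫ β) :
    ∃ K : Y ⟶ po.P, K ≫ po.π₁ = α ∧ K ≫ po.π₂ = β := by
  obtain ⟨Q, q₁, q₂, hQ⟩ := S.pullback_exists p p hp
  obtain ⟨K, hK⟩ := S.exists_lower_filler hw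
    (po.fib q₁ q₂ hQ (hQ.lift _ _ po.w) (by simp) (by simp)) (m := H)
    (n := hQ.lift α β hαβ) (by apply hQ.hom_ext <;> simp [h₁, h₂])
  refine ⟨K, ?_, ?_⟩
  · simpa using congrArg (· ≫ q₁) hK
  · simpa using congrArg (· ≫ q₂) hK

/-- Weak equivalences are epic up to fibrewise homotopy. -/
theorem fibrewiseHomotopic_of_weq {X Y E B : C} {w : X ⟶ Y} (hw : S.Weq w) {p : E ⟶ B}
    (hp : S.Fib p) {α β : Y ⟶ E} (hαβ : α ≫ p = β ≫ p)
    (h : FibrewiseHomotopic S.Weq S.Fib p (w ≫ α) (w ≫ β)) :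
    FibrewiseHomotopic S.Weq S.Fib p α β := by
  obtain ⟨po, H, h₁, h₂⟩ := h
  obtain ⟨K, hK⟩ := S.exists_homotopy_of_weq hw hp po hαβ H h₁ h₂
  exact ⟨po, K, hK⟩

theorem fibrewiseHomotopic_of_eq {X E B : C} {p : E ⟶ B} (hp : S.Fib p) {α β : X ⟶ E}
    (h : α = β) : FibrewiseHomotopic S.Weq S.Fib p α β := by
  obtain ⟨po⟩ := S.nonempty_fibPathObj hp
  exact ⟨po, α ≫ po.r, by simp [po.r_π₁], by simp [po.r_π₂, h]⟩

theorem fibrewiseHomotopic_of_weq_of_eq {X Y E B : C} {w : X ⟶ Y} (hw : S.Weq w) {p : E ⟶ B}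
    (hp : S.Fib p) {α β : Y ⟶ E} (hαβ : α ≫ p = β ≫ p) (h : w ≫ α = w ≫ β) :
    FibrewiseHomotopic S.Weq S.Fib p α β :=
  S.fibrewiseHomotopic_of_weq hw hp hαβ (S.fibrewiseHomotopic_of_eq hp h)

theorem exists_homotopy {X E B : C} {p : E ⟶ B} (hp : S.Fib p) {α β : X ⟶ E}
    (h : FibrewiseHomotopic S.Weq S.Fib p α β) (po : FibPathObj S.Weq S.Fib p) :
    ∃ H : X ⟶ po.P, H ≫ po.π₁ = α ∧ H ≫ po.π₂ = β := by
  obtain ⟨po', H, rfl, rfl⟩ := h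
  obtain ⟨K, h₁, h₂⟩ := S.exists_homotopy_of_weq po'.weq_r hp po po'.w po.r
    (by simp [po.r_π₁, po'.r_π₁]) (by simp [po.r_π₂, po'.r_π₂])
  exact ⟨H ≫ K, by simp [h₁], by simp [h₂]⟩

theorem fibrewiseHomotopic_trans {X E B : C} {p : E ⟶ B} (hp : S.Fib p) {α β γ : X ⟶ E}
    (h : FibrewiseHomotopic S.Weq S.Fib p α β) (h' : FibrewiseHomotopic S.Weq S.Fib p β γ) :
    FibrewiseHomotopic S.Weq S.Fib p α γ := by
  obtain ⟨po, H, rfl, rfl⟩ := h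
  obtain ⟨K, hK, rfl⟩ := S.exists_homotopy hp h' po
  have hπ := S.fib_π₁ hp po
  obtain ⟨Q, q₁, q₂, hQ⟩ := S.pullback_exists po.π₂ po.π₁ hπ
  have hq := S.acyc_fib_stable _ _ _ _ hQ hπ (S.weq_π₁ po)
  let d : E ⟶ Q := hQ.lift po.r po.r (by rw [po.r_π₁, po.r_π₂])
  have hd : S.Weq d := S.weq_of_weq_comp_right hq (by simpa [d] using po.weq_r)
  have key : FibrewiseHomotopic S.Weq S.Fib p (q₁ ≫ po.π₁) (q₂ ≫ po.π₂) := by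
    refine S.fibrewiseHomotopic_of_weq_of_eq hd hp ?_ ?_
    · rw [Category.assoc, po.w, ← Category.assoc, hQ.w, Category.assoc, Category.assoc, po.w]
    · simp [d, po.r_π₁, po.r_π₂]
  simpa using key.precomp (hQ.lift H K hK.symm)

theorem fibrewiseHomotopic_map {X E B E' B' : C} {p : E ⟶ B} {p' : E' ⟶ B'} (hp' : S.Fib p')
    {α β : X ⟶ E} (h : FibrewiseHomotopic S.Weq S.Fib p α β) {j : E ⟶ E'} (n : B ⟶ B')
    (hj : j ≫ p' = p ≫ n) :
    FibrewiseHomotopic S.Weq S.Fib p' (α ≫ j) (β ≫ j) := by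
  obtain ⟨po, H, rfl, rfl⟩ := h
  have key : FibrewiseHomotopic S.Weq S.Fib p' (po.π₁ ≫ j) (po.π₂ ≫ j) := by
    refine S.fibrewiseHomotopic_of_weq_of_eq po.weq_r hp' ?_ ?_
    · simp only [Category.assoc, hj]
      rw [← Category.assoc, po.w, Category.assoc]
    · rw [← Category.assoc, po.r_π₁, ← Category.assoc, po.r_π₂]
  simpa using key.precomp H

theorem homotopic_of_eq {X E : C} {α β : X ⟶ E} (h : α = β) : Homotopic S.Weq S.Fib α β :=
  S.fibrewiseHomotopic_of_eq (S.fib_terminal E) h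

theorem homotopic_trans {X E : C} {α β γ : X ⟶ E} (h : Homotopic S.Weq S.Fib α β)
    (h' : Homotopic S.Weq S.Fib β γ) : Homotopic S.Weq S.Fib α γ :=
  S.fibrewiseHomotopic_trans (S.fib_terminal E) h h'

theorem homotopic_map {X E E' : C} {α β : X ⟶ E} (h : Homotopic S.Weq S.Fib α β)
    (j : E ⟶ E') : Homotopic S.Weq S.Fib (α ≫ j) (β ≫ j) :=
  S.fibrewiseHomotopic_map (S.fib_terminal E') h (𝟙 _) (Subsingleton.elim _ _)

theorem homotopic_of_fibrewiseHomotopic {X E B : C} {p : E ⟶ B} {α β : X ⟶ E}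
    (h : FibrewiseHomotopic S.Weq S.Fib p α β) : Homotopic S.Weq S.Fib α β := by
  simpa [Homotopic] using S.fibrewiseHomotopic_map (S.fib_terminal E) h (j := 𝟙 E)
    (terminal.from B) (Subsingleton.elim _ _)

theorem fibrewiseHomotopic_of_acyclic {T X Y : C} {q : X ⟶ Y} (hq : S.Fib q) (hq' : S.Weq q)
    {α β : T ⟶ X} (h : α ≫ q = β ≫ q) : FibrewiseHomotopic S.Weq S.Fib q α β := by
  obtain ⟨Q, q₁, q₂, hQ⟩ := S.pullback_exists q q hq
  have key : FibrewiseHomotopic S.Weq S.Fib q q₁ q₂ :=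
    S.fibrewiseHomotopic_of_weq_of_eq (w := hQ.lift (𝟙 X) (𝟙 X) rfl)
      (S.weq_of_section (S.acyc_fib_stable _ _ _ _ hQ hq hq') (by simp)) hq hQ.w (by simp)
  simpa using key.precomp (hQ.lift α β h)

/-- Squares from a weak equivalence to a fibration have a filler whose lower triangle commutes
strictly and whose upper triangle commutes up to fibrewise homotopy. -/
theorem exists_filler {X Y E B : C} {w : X ⟶ Y} (hw : S.Weq w) {p : E ⟶ B}
    (hp : S.Fib p) {m : X ⟶ E} {n : Y ⟶ B} (h : m ≫ p = w ≫ n) :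
    ∃ l : Y ⟶ E, l ≫ p = n ∧ FibrewiseHomotopic S.Weq S.Fib p (w ≫ l) m := by
  obtain ⟨X', i, q, j, hq, hq', rfl, rfl, hj⟩ := S.exists_acyclic_factorisation hw hp h
  obtain ⟨s, hs⟩ := S.acyc_fib_section q hq hq'
  refine ⟨s ≫ j, by rw [Category.assoc, hj, ← Category.assoc, hs, Category.id_comp], ?_⟩
  have key : FibrewiseHomotopic S.Weq S.Fib q ((i ≫ q) ≫ s) i :=
    S.fibrewiseHomotopic_of_acyclic hq hq' (by simp [hs])
  simpa using S.fibrewiseHomotopic_map hp key n hj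

/-- A triangle over a fibration that commutes up to homotopy can be made strictly commutative. -/
theorem exists_rectification {T B A : C} {g : B ⟶ A} (hg : S.Fib g) {e : T ⟶ B} {x : T ⟶ A}
    (h : Homotopic S.Weq S.Fib (e ≫ g) x) :
    ∃ e' : T ⟶ B, e' ≫ g = x ∧ Homotopic S.Weq S.Fib e' e := by
  obtain ⟨po, H, hH, rfl⟩ := h
  have hπ := S.fib_π₁ (S.fib_terminal A) po
  obtain ⟨Q, q₁, q₂, hQ⟩ := S.pullback_exists g po.π₁ hπ
  let σ : B ⟶ Q := hQ.lift (𝟙 B) (g ≫ po.r) (by simp [po.r_π₁])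
  have hσ : S.Weq σ :=
    S.weq_of_section (S.acyc_fib_stable _ _ _ _ hQ hπ (S.weq_π₁ po)) (by simp [σ])
  obtain ⟨l, hl, hl'⟩ := S.exists_filler hσ hg (m := 𝟙 B) (n := q₂ ≫ po.π₂)
    (by simp [σ, po.r_π₂])
  have key : Homotopic S.Weq S.Fib l q₁ := by
    refine S.fibrewiseHomotopic_of_weq hσ (S.fib_terminal B) (Subsingleton.elim _ _) ?_
    change Homotopic S.Weq S.Fib (σ ≫ l) (σ ≫ q₁)
    simpa [σ] using S.homotopic_of_fibrewiseHomotopic hl'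
  refine ⟨hQ.lift e H hH.symm ≫ l, by simp [hl], ?_⟩
  simpa using key.precomp (hQ.lift e H hH.symm)

/-- Fibrewise homotopies are stable under pullback. -/
theorem homotopic_of_isPullback {T V X Y Z : C} {p₁ : V ⟶ X} {p₂ : V ⟶ Y} {f : X ⟶ Z}
    {g : Y ⟶ Z} (hV : IsPullback p₁ p₂ f g) (hf : S.Fib f) {α β : T ⟶ V}
    (h₁ : FibrewiseHomotopic S.Weq S.Fib f (α ≫ p₁) (β ≫ p₁)) (h₂ : α ≫ p₂ = β ≫ p₂) :
    Homotopic S.Weq S.Fib α β := by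
  obtain ⟨po, H, hH₁, hH₂⟩ := h₁
  have hπ := S.fib_π₁ hf po
  obtain ⟨Q, q₁, q₂, hQ⟩ := S.pullback_exists p₁ po.π₁ hπ
  let ρ : V ⟶ Q := hQ.lift (𝟙 V) (p₁ ≫ po.r) (by simp [po.r_π₁])
  have hρ : S.Weq ρ :=
    S.weq_of_section (S.acyc_fib_stable _ _ _ _ hQ hπ (S.weq_π₁ po)) (by simp [ρ])
  let d : Q ⟶ V := hV.lift (q₂ ≫ po.π₂) (q₁ ≫ p₂) (by
    rw [Category.assoc, ← po.w, ← Category.assoc, ← hQ.w, Category.assoc, hV.w, Category.assoc])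
  have key : Homotopic S.Weq S.Fib q₁ d := by
    refine S.fibrewiseHomotopic_of_weq_of_eq hρ (S.fib_terminal V) (Subsingleton.elim _ _) ?_
    apply hV.hom_ext <;> simp [ρ, d, po.r_π₂]
  have hβ : hQ.lift α H hH₁.symm ≫ d = β := by
    apply hV.hom_ext
    · simp [d, hH₂]
    · simp [d, ← h₂]
  simpa [hβ] using key.precomp (hQ.lift α H hH₁.symm)

/-- A strict pullback along a fibration is a homotopy pullback. -/
theorem isHomotopyPullback_of_isPullback {X Y Z V : C} {f : X ⟶ Z} {g : Y ⟶ Z} {p₁ : V ⟶ X}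
    {p₂ : V ⟶ Y} (hV : IsPullback p₁ p₂ f g) (hf : S.Fib f) :
    IsHomotopyPullback S.Weq S.Fib f g p₁ p₂ := by
  obtain ⟨po⟩ := S.path_obj Z
  have hπ := S.fib_π₁ (S.fib_terminal Z) po
  obtain ⟨E, e₁, e₂, hE⟩ := S.pullback_exists f po.π₁ hπ
  have hε := S.fib_mappingPath po hE
  obtain ⟨W, b, z, hW⟩ := S.pullback_exists g (e₂ ≫ po.π₂) hε
  let σ : X ⟶ E := hE.lift (𝟙 X) (f ≫ po.r) (by simp [po.r_π₁])
  have hσε : σ ≫ e₂ ≫ po.π₂ = f := by simp [σ, po.r_π₂]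
  have hσ : S.Weq σ :=
    S.weq_of_section (S.acyc_fib_stable _ _ _ _ hE hπ (S.weq_π₁ po)) (by simp [σ])
  obtain ⟨l, hl, hσl⟩ := S.exists_filler hσ hf (m := 𝟙 X) (n := e₂ ≫ po.π₂) (by simp [hσε])
  have hlσ : FibrewiseHomotopic S.Weq S.Fib (e₂ ≫ po.π₂) (l ≫ σ) (𝟙 E) := by
    refine S.fibrewiseHomotopic_of_weq hσ hε (by simp only [Category.assoc, hσε, hl,
      Category.id_comp]) ?_
    simpa using S.fibrewiseHomotopic_map hε hσl (j := σ) (𝟙 Z) (by simpa using hσε)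
  refine ⟨po, W, z ≫ e₁, b, z ≫ e₂, by simp [hE.w], by simp [hW.w], ?_,
    p₁ ≫ f ≫ po.r, by simp [po.r_π₁], by simp [po.r_π₂, hV.w], ?_⟩
  · intro T a' b' c' ha hb
    refine ⟨hW.lift b' (hE.lift a' c' ha.symm) (by simp [hb]), ⟨?_, ?_, ?_⟩, ?_⟩
    · simp [← Category.assoc]
    · simp
    · simp [← Category.assoc]
    · rintro t ⟨h₁, h₂, h₃⟩
      apply hW.hom_ext
      · simpa using h₂
      · apply hE.hom_ext
        · simpa using h₁
        · simpa using h₃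
  · intro t h₁ h₂ h₃
    have htz : t ≫ z = p₁ ≫ σ := by
      apply hE.hom_ext
      · simpa [σ] using h₁
      · simpa [σ] using h₃
    let φ : W ⟶ V := hV.lift (z ≫ l) b (by simp [hl, hW.w])
    refine ⟨φ, ?_, ?_⟩
    · refine S.homotopic_of_isPullback hV hf ?_ (by simp [φ, h₂])
      have h : (t ≫ φ) ≫ p₁ = p₁ ≫ σ ≫ l := by
        simp only [φ, Category.assoc, hV.lift_fst]
        rw [← Category.assoc, htz, Category.assoc]
      rw [h]
      simpa using hσl.precomp p₁
    · refine S.homotopic_of_isPullback hW.flip hε ?_ (by simp [φ, h₂])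
      have h : (φ ≫ t) ≫ z = z ≫ l ≫ σ := by
        rw [Category.assoc, htz, ← Category.assoc, hV.lift_fst, Category.assoc]
      rw [h]
      simpa using hlσ.precomp z

/-- A strict pullback maps to any homotopy pullback, compatibly with the projections up to
homotopy. -/
theorem exists_comparison_of_isHomotopyPullback {X Y Z V V' : C} {f : X ⟶ Z} {g : Y ⟶ Z}
    {p₁ : V ⟶ X} {p₂ : V ⟶ Y} (w : p₁ ≫ f = p₂ ≫ g) {p₁' : V' ⟶ X} {p₂' : V' ⟶ Y}
    (h : IsHomotopyPullback S.Weq S.Fib f g p₁' p₂') :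
    ∃ s : V ⟶ V', Homotopic S.Weq S.Fib (s ≫ p₁') p₁ ∧
      Homotopic S.Weq S.Fib (s ≫ p₂') p₂ := by
  obtain ⟨po, W, a, b, c, -, -, hW, H, hH₁, hH₂, hequiv⟩ := h
  obtain ⟨t, ⟨rfl, rfl, htc⟩, -⟩ := hW p₁' p₂' H hH₁ hH₂
  obtain ⟨t₀, ⟨rfl, rfl, -⟩, -⟩ := hW p₁ p₂ (p₁ ≫ f ≫ po.r) (by simp [po.r_π₁])
    (by simp [po.r_π₂, w])
  obtain ⟨k, -, hk⟩ := hequiv t rfl rfl htc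
  have key := hk.precomp t₀
  refine ⟨t₀ ≫ k, ?_, ?_⟩
  · simpa using S.homotopic_map key a
  · simpa using S.homotopic_map key b

end PathCatStruct

end Paper

namespace Paper

/-- In a path category, every homotopy weak dependent product
of two fibrations `f : A ⟶ I` and `g : B ⟶ A` is a homotopy full diagram over
`f, g`. -/
theorem homotopyWeakDepProd_isHomotopyFullDiagram
    {C : Type u} [Category.{v} C] [HasTerminal C]
    (S : PathCatStruct C) {I A B U V : C}
    (f : A ⟶ I) (hf : S.Fib f) (g : B ⟶ A) (hg : S.Fib g)
    (u : U ⟶ I) (p₁ : V ⟶ U) (p₂ : V ⟶ A) (e : V ⟶ B)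
    (hwdp : IsHomotopyWeakDepProd S.Weq S.Fib f g u p₁ p₂ e) :
    IsHomotopyFullDiagram S.Weq S.Fib f g u p₁ p₂ e := by
  obtain ⟨hu, hV, he, hwdp⟩ := hwdp
  refine ⟨S.homotopic_of_eq hV.w, S.isHomotopyPullback_of_isPullback hV hu,
    S.homotopic_of_eq he, ?_⟩
  intro U' V' u' p₁' p₂' e' _ hV' he'
  obtain ⟨P, r₁, r₂, hP⟩ := S.pullback_exists u' f hf
  obtain ⟨s, hs₁, hs₂⟩ := S.exists_comparison_of_isHomotopyPullback hP.w hV'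
  obtain ⟨e'', he'', hse⟩ := S.exists_rectification hg (e := s ≫ e') (x := r₂)
    (S.homotopic_trans (by simpa using he'.precomp s) hs₂)
  obtain ⟨h, rfl, hh⟩ := hwdp u' r₁ r₂ e'' hP he''
  let m : P ⟶ V := hV.lift (r₁ ≫ h) r₂ (by simpa using hP.w)
  have hm₁ : m ≫ p₁ = r₁ ≫ h := hV.lift_fst _ _ _
  have hm₂ : m ≫ p₂ = r₂ := hV.lift_snd _ _ _
  have hm : IsPullback m r₁ p₁ h :=
    IsPullback.of_right (by simpa [hm₂] using hP.flip) hm₁ hV.flip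
  refine ⟨h, S.homotopic_of_eq rfl, P, m, r₁, S.homotopic_of_eq hm₁,
    S.isHomotopyPullback_of_isPullback hm (S.fib_stable _ _ _ _ hV hf), s, hs₁, ?_⟩
  exact S.homotopic_trans hse.symm
    (S.homotopic_of_fibrewiseHomotopic (hh m hm₁ hm₂).symm)

end Paper
end
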